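/- For every α ∈ (1/2, 1) and every constant c₀ > 0 there exist constants C₁, C₂ > 0, depending only on α and c₀, such that for all integers S ≥ 2 and n ≥ 2 with n·ln S ≥ c₀·S^{1/α}, the minimax risk for estimating F_α(P) over P ∈ M_S under the Poissonized sampling model with parameter n satisfies C₁·( S²/(n·ln n)^{2α} + S^{2−2α}/n ) ≤ inf_{F̂} sup_{P ∈ M_S} E_P[(F̂(Z) − F_α(P))²] ≤ C₂·( S²/(n·ln n)^{2α} + S^{2−2α}/n ). -/

import Mathlib

open scoped BigOperators ENNReal

/-- The probability simplex on `S` outcomes. -/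
def simplex (S : ℕ) : Set (Fin S → ℝ) :=
  {P | (∀ i, 0 ≤ P i) ∧ ∑ i, P i = 1}

/-- Joint pmf of independent Poisson observations `Z i ~ Poisson (lam * P i)`. -/
noncomputable def poissonPMF (S : ℕ) (lam : ℝ) (P : Fin S → ℝ) (z : Fin S → ℕ) : ℝ :=
  ∏ i, Real.exp (-(lam * P i)) * (lam * P i) ^ (z i) / (Nat.factorial (z i) : ℝ)

/-- Expected squared error of an estimator under the Poissonized model. -/
noncomputable def poissonRisk (S : ℕ) (lam : ℝ) (P : Fin S → ℝ) (t : ℝ)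
    (est : (Fin S → ℕ) → ℝ) : ℝ≥0∞ :=
  ∑' z : Fin S → ℕ, ENNReal.ofReal (poissonPMF S lam P z * (est z - t) ^ 2)

/-- Minimax risk for estimating `F P` under the Poissonized model. -/
noncomputable def poissonMinimax (S : ℕ) (lam : ℝ) (F : (Fin S → ℝ) → ℝ) : ℝ≥0∞ :=
  ⨅ est : (Fin S → ℕ) → ℝ, ⨆ P ∈ simplex S, poissonRisk S lam P (F P) est

/-- The power-sum functional `F_α(P) = ∑ i, (P i)^α` (real power; `0^α = 0` for `α > 0`). -/
noncomputable def Falpha (S : ℕ) (α : ℝ) (P : Fin S → ℝ) : ℝ :=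
  ∑ i, P i ^ α

open MeasureTheory Set
open ProbabilityTheory hiding poissonPMF
open scoped NNReal

/-- A function bounded on `(0, ∞)` and dominated by a power larger than `p` at the origin is
integrable against `t ^ (-1 - p)`. -/
lemma integrableOn_mul_rpow_of_le {φ : ℝ → ℝ} {p q : ℝ} (hp : 0 < p) (hpq : p < q)
    (hφ : Continuous φ) (h0 : ∀ t, 0 < t → 0 ≤ φ t) (h2 : ∀ t, 0 < t → φ t ≤ 2)
    (hq : ∀ t, 0 < t → φ t ≤ t ^ q) :
    IntegrableOn (fun t => φ t * t ^ (-1 - p)) (Ioi 0) := by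
  have hmeas : AEStronglyMeasurable (fun t : ℝ => φ t * t ^ (-1 - p)) volume := by
    apply Measurable.aestronglyMeasurable
    exact hφ.measurable.mul (measurable_id.pow_const _)
  rw [← Ioc_union_Ioi_eq_Ioi (zero_le_one' ℝ)]
  refine IntegrableOn.union ?_ ?_
  · have h : IntegrableOn (fun t : ℝ => t ^ (q - 1 - p)) (Ioc 0 1) := by
      have := (intervalIntegral.intervalIntegrable_rpow' (a := 0) (b := 1)
        (r := q - 1 - p) (by linarith))
      rwa [intervalIntegrable_iff_integrableOn_Ioc_of_le zero_le_one] at this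
    refine Integrable.mono' h hmeas.restrict ?_
    refine (ae_restrict_iff' measurableSet_Ioc).2 (Filter.Eventually.of_forall fun t ht => ?_)
    rw [Real.norm_of_nonneg (mul_nonneg (h0 t ht.1) (Real.rpow_nonneg ht.1.le _))]
    calc φ t * t ^ (-1 - p) ≤ t ^ q * t ^ (-1 - p) :=
          mul_le_mul_of_nonneg_right (hq t ht.1) (Real.rpow_nonneg ht.1.le _)
      _ = t ^ (q - 1 - p) := by rw [← Real.rpow_add ht.1]; ring_nf
  · have h : IntegrableOn (fun t : ℝ => 2 * t ^ (-1 - p)) (Ioi 1) :=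
      (integrableOn_Ioi_rpow_of_lt (by linarith) one_pos).const_mul 2
    refine Integrable.mono' h hmeas.restrict ?_
    refine (ae_restrict_iff' measurableSet_Ioi).2 (Filter.Eventually.of_forall fun t ht => ?_)
    have ht0 : (0 : ℝ) < t := zero_lt_one.trans ht
    rw [Real.norm_of_nonneg (mul_nonneg (h0 t ht0) (Real.rpow_nonneg ht0.le _))]
    exact mul_le_mul_of_nonneg_right (h2 t ht0) (Real.rpow_nonneg ht0.le _)

/-- Scaling of the integral against `t ^ (-1 - p)`. -/
lemma integral_comp_mul_rpow (φ : ℝ → ℝ) {p x : ℝ} (hx : 0 < x) :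
    ∫ t in Ioi (0 : ℝ), φ (x * t) * t ^ (-1 - p)
      = x ^ p * ∫ t in Ioi (0 : ℝ), φ t * t ^ (-1 - p) := by
  have h := integral_comp_mul_left_Ioi (fun u => φ u * u ^ (-1 - p)) 0 hx
  rw [mul_zero, smul_eq_mul] at h
  have h' : ∫ t in Ioi (0 : ℝ), φ (x * t) * (x * t) ^ (-1 - p)
      = x ^ (-1 - p) * ∫ t in Ioi (0 : ℝ), φ (x * t) * t ^ (-1 - p) := by
    rw [← integral_const_mul]
    refine setIntegral_congr_fun measurableSet_Ioi fun t ht => ?_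
    rw [Real.mul_rpow hx.le (le_of_lt ht)]; ring
  rw [h'] at h
  have hx1 : x ^ (-1 - p) = x⁻¹ * (x ^ p)⁻¹ := by
    rw [sub_eq_add_neg, Real.rpow_add hx, Real.rpow_neg_one, Real.rpow_neg hx.le]
  have hxp : 0 < x ^ p := Real.rpow_pos_of_pos hx p
  rw [hx1, mul_assoc] at h
  have h3 := mul_left_cancel₀ (inv_ne_zero hx.ne') h
  rw [← h3, ← mul_assoc, mul_inv_cancel₀ hxp.ne', one_mul]

/-- The scaled version of a function as in `integrableOn_mul_rpow_of_le` is integrable too. -/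
lemma integrableOn_comp_mul_rpow {φ : ℝ → ℝ} {p x : ℝ} (hx : 0 < x)
    (h : IntegrableOn (fun t => φ t * t ^ (-1 - p)) (Ioi 0)) :
    IntegrableOn (fun t => φ (x * t) * t ^ (-1 - p)) (Ioi 0) := by
  have h1 := (integrableOn_Ioi_comp_mul_left_iff (fun u => φ u * u ^ (-1 - p)) 0 hx).2
    (by rwa [mul_zero])
  have h2 : IntegrableOn (fun t => (x ^ (-1 - p))⁻¹ * (φ (x * t) * (x * t) ^ (-1 - p))) (Ioi 0) :=
    h1.const_mul _
  refine h2.congr_fun (fun t ht => ?_) measurableSet_Ioi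
  have hxp : x ^ (-1 - p) ≠ 0 := (Real.rpow_pos_of_pos hx _).ne'
  simp only
  rw [Real.mul_rpow hx.le (le_of_lt ht)]
  field_simp

lemma integral_mul_rpow_pos {φ : ℝ → ℝ} {p : ℝ}
    (h : IntegrableOn (fun t => φ t * t ^ (-1 - p)) (Ioi 0))
    (h0 : ∀ t, 0 < t → 0 ≤ φ t) (h1 : ∀ t ∈ Ioo (0 : ℝ) 1, 0 < φ t) :
    0 < ∫ t in Ioi (0 : ℝ), φ t * t ^ (-1 - p) := by
  have hsub : 0 < ∫ t in Ioo (0 : ℝ) 1, φ t * t ^ (-1 - p) := by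
    have hI : IntegrableOn (fun t => φ t * t ^ (-1 - p)) (Ioo 0 1) :=
      h.mono_set Ioo_subset_Ioi_self
    rw [setIntegral_pos_iff_support_of_nonneg_ae _ hI]
    · refine lt_of_lt_of_le ?_ (measure_mono (s := Ioo (0 : ℝ) 1) fun t ht => ⟨?_, ht⟩)
      · simp
      · exact (mul_pos (h1 t ht) (Real.rpow_pos_of_pos ht.1 _)).ne'
    · refine (ae_restrict_iff' measurableSet_Ioo).2 (Filter.Eventually.of_forall fun t ht => ?_)
      exact mul_nonneg (h0 t ht.1) (Real.rpow_nonneg ht.1.le _)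
  refine hsub.trans_le (setIntegral_mono_set h ?_ Ioo_subset_Ioi_self.eventuallyLE)
  refine (ae_restrict_iff' measurableSet_Ioi).2 (Filter.Eventually.of_forall fun t ht => ?_)
  exact mul_nonneg (h0 t ht) (Real.rpow_nonneg (le_of_lt ht) _)

/-- The power `x ^ p`, `0 < p < 1`, as a mixture of the functions `1 - exp (-x t)`. -/
lemma exists_rpow_eq_integral_exp {p : ℝ} (hp : 0 < p) (hp1 : p < 1) :
    ∃ c : ℝ, 0 < c ∧ ∀ x : ℝ, 0 ≤ x →
      IntegrableOn (fun t : ℝ => (1 - Real.exp (-(x * t))) * t ^ (-1 - p)) (Ioi 0) ∧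
      x ^ p = c * ∫ t in Ioi (0 : ℝ), (1 - Real.exp (-(x * t))) * t ^ (-1 - p) := by
  have h0 : ∀ t : ℝ, 0 < t → 0 ≤ 1 - Real.exp (-t) := fun t ht => by
    have := Real.exp_le_one_iff.2 (neg_nonpos.2 ht.le); linarith
  have hI := integrableOn_mul_rpow_of_le (φ := fun t => 1 - Real.exp (-t)) hp hp1
    (by fun_prop) h0 (fun t _ => by have := Real.exp_pos (-t); linarith)
    (fun t _ => by have := Real.add_one_le_exp (-t); rw [Real.rpow_one]; linarith)
  have hpos := integral_mul_rpow_pos hI h0 (fun t ht => by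
    have := Real.exp_lt_one_iff.2 (neg_lt_zero.2 ht.1); linarith)
  refine ⟨_, inv_pos.2 hpos, fun x hx => ?_⟩
  rcases hx.eq_or_lt with rfl | hx
  · simp [Real.zero_rpow hp.ne']
  · refine ⟨integrableOn_comp_mul_rpow hx hI, ?_⟩
    rw [integral_comp_mul_rpow (fun t => 1 - Real.exp (-t)) hx, mul_comm, mul_assoc,
      mul_inv_cancel₀ hpos.ne', mul_one]

lemma integrableOn_one_sub_cos_mul_rpow {p : ℝ} (hp : 0 < p) (hp2 : p < 2) :
    IntegrableOn (fun t : ℝ => (1 - Real.cos t) * t ^ (-1 - p)) (Ioi 0) :=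
  integrableOn_mul_rpow_of_le (φ := fun t => 1 - Real.cos t) hp hp2
    (by fun_prop) (fun t _ => by have := Real.cos_le_one t; linarith)
    (fun t _ => by have := Real.neg_one_le_cos t; linarith)
    (fun t _ => by
      have := Real.one_sub_sq_div_two_le_cos (x := t)
      rw [Real.rpow_two]; nlinarith [sq_nonneg t])

/-- The power `|x| ^ p`, `0 < p < 2`, as a mixture of the functions `1 - cos (x s)`. -/
lemma exists_abs_rpow_eq_integral_cos {p : ℝ} (hp : 0 < p) (hp2 : p < 2) :
    ∃ c : ℝ, 0 < c ∧ ∀ x : ℝ,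
      IntegrableOn (fun s : ℝ => (1 - Real.cos (x * s)) * s ^ (-1 - p)) (Ioi 0) ∧
      |x| ^ p = c * ∫ s in Ioi (0 : ℝ), (1 - Real.cos (x * s)) * s ^ (-1 - p) := by
  have hI := integrableOn_one_sub_cos_mul_rpow hp hp2
  have hpos := integral_mul_rpow_pos (φ := fun t => 1 - Real.cos t) hI
    (fun t _ => by have := Real.cos_le_one t; linarith) (fun t ht => by
      have := Real.cos_lt_cos_of_nonneg_of_le_pi le_rfl
        (by linarith [ht.2, Real.pi_gt_three]) ht.1
      rw [Real.cos_zero] at this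
      linarith)
  refine ⟨_, inv_pos.2 hpos, fun x => ?_⟩
  rcases (abs_nonneg x).eq_or_lt with hx | hx
  · have hx0 : x = 0 := abs_eq_zero.1 hx.symm
    simp [hx0, Real.zero_rpow hp.ne']
  · have hcos : ∀ s, Real.cos (x * s) = Real.cos (|x| * s) := fun s => by
      rcases abs_choice x with h | h <;> simp [h]
    simp only [hcos]
    refine ⟨integrableOn_comp_mul_rpow (φ := fun t => 1 - Real.cos t) hx hI, ?_⟩
    rw [integral_comp_mul_rpow (fun t => 1 - Real.cos t) hx, mul_comm, mul_assoc,
      mul_inv_cancel₀ hpos.ne', mul_one]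

lemma Gamma_nat_add_half_mul (k : ℕ) :
    Real.Gamma (k + 1 / 2) * (4 ^ k * k.factorial) = (2 * k).factorial * √Real.pi := by
  induction k with
  | zero => simp [-one_div, Real.Gamma_one_half_eq]
  | succ k ih =>
    have h : ((k + 1 : ℕ) : ℝ) + 1 / 2 = (k + 1 / 2) + 1 := by push_cast; ring
    rw [h, Real.Gamma_add_one (by positivity), show 2 * (k + 1) = 2 * k + 1 + 1 by ring,
      Nat.factorial_succ (2 * k + 1), Nat.factorial_succ (2 * k), Nat.factorial_succ k]
    push_cast
    linear_combination (4 * ((k : ℝ) + 1 / 2) * (k + 1)) * ih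

lemma integral_pow_mul_exp_neg_sq (k : ℕ) :
    ∫ y : ℝ, y ^ (2 * k) * Real.exp (-y ^ 2) = Real.Gamma (k + 1 / 2) := by
  have h := integral_comp_abs (f := fun y : ℝ => y ^ (2 * k) * Real.exp (-y ^ 2))
  have h2 := integral_rpow_mul_exp_neg_rpow (p := 2) (q := (2 * k : ℕ)) two_pos
    (by have : (0 : ℝ) ≤ (2 * k : ℕ) := Nat.cast_nonneg _
        linarith)
  simp only [Real.rpow_natCast, Real.rpow_two] at h2
  simp only [pow_mul, sq_abs] at h h2 ⊢
  rw [h, h2]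
  push_cast
  rw [show ((2 : ℝ) * k + 1) / 2 = k + 1 / 2 by ring]
  ring

/-- The law of the signed square root of a symmetrised `Gamma(k + 1/2)` variable: the density is
`y ^ (2 k) exp (-y ^ 2) / Γ(k + 1/2)`. -/
noncomputable def sqrtGammaDensity (k : ℕ) (y : ℝ) : ℝ :=
  y ^ (2 * k) * Real.exp (-y ^ 2) / Real.Gamma (k + 1 / 2)

lemma sqrtGammaDensity_nonneg (k : ℕ) (y : ℝ) : 0 ≤ sqrtGammaDensity k y :=
  div_nonneg (mul_nonneg (by rw [pow_mul]; positivity) (Real.exp_nonneg _))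
    (Real.Gamma_pos_of_pos (by positivity)).le

lemma measurable_sqrtGammaDensity (k : ℕ) : Measurable (sqrtGammaDensity k) := by
  unfold sqrtGammaDensity; fun_prop

noncomputable def sqrtGammaMeasure (k : ℕ) : Measure ℝ :=
  volume.withDensity fun y => ENNReal.ofReal (sqrtGammaDensity k y)

instance (k : ℕ) : IsProbabilityMeasure (sqrtGammaMeasure k) := by
  have hΓ : 0 < Real.Gamma (k + 1 / 2) := Real.Gamma_pos_of_pos (by positivity)
  have h1 : ∫ y, sqrtGammaDensity k y = 1 := by
    unfold sqrtGammaDensity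
    rw [integral_div, integral_pow_mul_exp_neg_sq, div_self hΓ.ne']
  refine ⟨?_⟩
  rw [sqrtGammaMeasure, withDensity_apply _ MeasurableSet.univ, setLIntegral_univ,
    ← ofReal_integral_eq_lintegral_ofReal _
      (Filter.Eventually.of_forall (sqrtGammaDensity_nonneg k)), h1, ENNReal.ofReal_one]
  exact not_imp_comm.1 integral_undef (by rw [h1]; exact one_ne_zero)

/-- The symmetrised Gaussian law with mean `± m` and variance `1/2`. -/
noncomputable def symGaussian (m : ℝ) : Measure ℝ :=
  (2⁻¹ : ℝ≥0∞) • (gaussianReal m 2⁻¹ + gaussianReal (-m) 2⁻¹)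

lemma hasSum_poisson_mul_sqrtGammaDensity (r : ℝ≥0) (y : ℝ) :
    HasSum (fun k : ℕ => Real.exp (-r) * r ^ k / k.factorial * sqrtGammaDensity k y)
      (2⁻¹ * (gaussianPDFReal (√r) 2⁻¹ y + gaussianPDFReal (-√r) 2⁻¹ y)) := by
  have h := (Real.hasSum_cosh (2 * √r * y)).mul_left
    (Real.exp (-r) * Real.exp (-y ^ 2) / √Real.pi)
  have hpi : 0 < √Real.pi := Real.sqrt_pos.2 Real.pi_pos
  have hr : √(r : ℝ) ^ 2 = r := Real.sq_sqrt r.2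
  convert! h using 1
  · funext k
    have hg := Gamma_nat_add_half_mul k
    have hΓ : 0 < Real.Gamma (k + 1 / 2) := Real.Gamma_pos_of_pos (by positivity)
    have hf : (0 : ℝ) < k.factorial := by positivity
    have hf2 : (0 : ℝ) < (2 * k).factorial := by positivity
    have : (2 * √r * y) ^ (2 * k) = 4 ^ k * (r : ℝ) ^ k * y ^ (2 * k) := by
      rw [mul_pow, mul_pow, pow_mul √(r : ℝ), hr, pow_mul 2]; norm_num
    rw [this, sqrtGammaDensity]
    generalize Real.Gamma (k + 1 / 2) = G at hg hΓ ⊢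
    field_simp
    linear_combination (-((r : ℝ) ^ k * y ^ (2 * k))) * hg
  · rw [gaussianPDFReal, gaussianPDFReal, Real.cosh_eq]
    have h2 : (2 : ℝ) * Real.pi * ((2⁻¹ : ℝ≥0) : ℝ) = Real.pi := by push_cast; ring
    have e1 : Real.exp (-(y - √r) ^ 2 / (2 * ((2⁻¹ : ℝ≥0) : ℝ)))
        = Real.exp (-r) * Real.exp (-y ^ 2) * Real.exp (2 * √r * y) := by
      rw [← Real.exp_add, ← Real.exp_add]; congr 1; push_cast; linear_combination (-1 : ℝ) * hr
    have e2 : Real.exp (-(y - -√r) ^ 2 / (2 * ((2⁻¹ : ℝ≥0) : ℝ)))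
        = Real.exp (-r) * Real.exp (-y ^ 2) * Real.exp (-(2 * √r * y)) := by
      rw [← Real.exp_add, ← Real.exp_add]; congr 1; push_cast; linear_combination (-1 : ℝ) * hr
    rw [h2, e1, e2]
    ring

/-- The Poisson mixture of the laws `sqrtGammaMeasure k` is a symmetrised Gaussian law. -/
lemma sum_poisson_smul_sqrtGammaMeasure (r : ℝ≥0) :
    Measure.sum (fun k : ℕ => ENNReal.ofReal (Real.exp (-r) * r ^ k / k.factorial) •
      sqrtGammaMeasure k) = symGaussian (√r) := by
  have hm : ∀ k, Measurable fun y => ENNReal.ofReal (sqrtGammaDensity k y) := fun k =>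
    (measurable_sqrtGammaDensity k).ennreal_ofReal
  have hv : (2⁻¹ : ℝ≥0) ≠ 0 := by norm_num
  simp only [sqrtGammaMeasure, symGaussian, gaussianReal_of_var_ne_zero _ hv]
  simp only [← withDensity_smul _ (hm _)]
  rw [← withDensity_tsum (fun k => (hm k).const_smul _),
    ← withDensity_add_left (measurable_gaussianPDF _ _), ← withDensity_smul _
      ((measurable_gaussianPDF _ _).add (measurable_gaussianPDF _ _))]
  congr 1
  funext y
  have hs := hasSum_poisson_mul_sqrtGammaDensity r y
  rw [ENNReal.tsum_apply]
  simp only [Pi.smul_apply, smul_eq_mul, Pi.add_apply, gaussianPDF]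
  rw [← ENNReal.ofReal_add (gaussianPDFReal_nonneg _ _ _) (gaussianPDFReal_nonneg _ _ _),
    show (2⁻¹ : ℝ≥0∞) = ENNReal.ofReal 2⁻¹ by
      rw [ENNReal.ofReal_inv_of_pos two_pos, ENNReal.ofReal_ofNat],
    ← ENNReal.ofReal_mul (by norm_num), ← hs.tsum_eq,
    ENNReal.ofReal_tsum_of_nonneg (fun k => mul_nonneg (by positivity)
      (sqrtGammaDensity_nonneg k y)) hs.summable]
  exact tsum_congr fun k => (ENNReal.ofReal_mul (by positivity)).symm

lemma ofReal_sq_integral_sub_le {Ω : Type*} {mΩ : MeasurableSpace Ω} (μ : Measure Ω)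
    [IsProbabilityMeasure μ] {f : Ω → ℝ} (hf : MemLp f 2 μ) (a : ℝ) :
    ENNReal.ofReal ((∫ x, f x ∂μ - a) ^ 2) ≤ ∫⁻ x, ENNReal.ofReal ((f x - a) ^ 2) ∂μ := by
  have h2 : MemLp (fun x => f x - a) 2 μ := hf.sub (memLp_const a)
  rw [← ofReal_integral_eq_lintegral_ofReal h2.integrable_sq
    (Filter.Eventually.of_forall fun x => sq_nonneg _)]
  refine ENNReal.ofReal_le_ofReal ?_
  have h := variance_nonneg (fun x => f x - a) μ
  rw [variance_eq_sub h2] at h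
  have h1 : ∫ x, (f x - a) ∂μ = ∫ x, f x ∂μ - a := by
    rw [integral_sub (hf.integrable one_le_two) (integrable_const a)]; simp
  rw [h1] at h
  simpa using h

/-- Averaging a function of the Gaussian observation over the conditional law given the Poisson
count preserves the mean and does not increase mean squared errors. -/
lemma integral_poissonMeasure_of_symGaussian (r : ℝ≥0) {f : ℝ → ℝ}
    (hf : ∀ m, MemLp f 2 (gaussianReal m 2⁻¹)) :
    MemLp (fun k : ℕ => ∫ y, f y ∂sqrtGammaMeasure k) 2 (poissonMeasure r) ∧
    ∫ k, (∫ y, f y ∂sqrtGammaMeasure k) ∂poissonMeasure r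
      = 2⁻¹ * (∫ y, f y ∂gaussianReal (√r) 2⁻¹ + ∫ y, f y ∂gaussianReal (-√r) 2⁻¹) ∧
    ∀ a : ℝ, ∫ k, ((∫ y, f y ∂sqrtGammaMeasure k) - a) ^ 2 ∂poissonMeasure r
      ≤ 2⁻¹ * (∫ y, (f y - a) ^ 2 ∂gaussianReal (√r) 2⁻¹
        + ∫ y, (f y - a) ^ 2 ∂gaussianReal (-√r) 2⁻¹) := by
  have hsym : ∀ m, MemLp f 2 (symGaussian m) := fun m => by
    refine MemLp.smul_measure ?_ (by simp)
    have hae : AEStronglyMeasurable f (gaussianReal m 2⁻¹ + gaussianReal (-m) 2⁻¹) :=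
      aestronglyMeasurable_add_measure_iff.2 ⟨(hf m).1, (hf (-m)).1⟩
    exact (memLp_two_iff_integrable_sq hae).2
      ((hf m).integrable_sq.add_measure (hf (-m)).integrable_sq)
  have hle : ∀ r : ℝ≥0, ∀ k : ℕ, ENNReal.ofReal (Real.exp (-r) * r ^ k / k.factorial) •
      sqrtGammaMeasure k ≤ symGaussian √r := fun r k => by
    rw [← sum_poisson_smul_sqrtGammaMeasure]
    exact Measure.le_sum (fun k : ℕ => ENNReal.ofReal (Real.exp (-r) * r ^ k / k.factorial) •
      sqrtGammaMeasure k) k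
  have hk : ∀ k, MemLp f 2 (sqrtGammaMeasure k) := fun k => by
    have h1 := (hsym _).mono_measure (hle 1 k)
    have hw : ENNReal.ofReal (Real.exp (-(1 : ℝ≥0)) * (1 : ℝ≥0) ^ k / k.factorial) ≠ 0 := by
      rw [Ne, ENNReal.ofReal_eq_zero, not_le]; push_cast; positivity
    have h2 := h1.smul_measure (c := (ENNReal.ofReal
      (Real.exp (-(1 : ℝ≥0)) * (1 : ℝ≥0) ^ k / k.factorial))⁻¹) (by simpa using hw)
    rwa [smul_smul, ENNReal.inv_mul_cancel hw ENNReal.ofReal_ne_top, one_smul] at h2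
  have hsq : ∀ a, ∫⁻ k, ENNReal.ofReal (((∫ y, f y ∂sqrtGammaMeasure k) - a) ^ 2)
      ∂poissonMeasure r ≤ ENNReal.ofReal (2⁻¹ * (∫ y, (f y - a) ^ 2 ∂gaussianReal (√r) 2⁻¹
        + ∫ y, (f y - a) ^ 2 ∂gaussianReal (-√r) 2⁻¹)) := fun a => by
    have hfa : ∀ m, Integrable (fun y => (f y - a) ^ 2) (gaussianReal m 2⁻¹) := fun m =>
      ((hf m).sub (memLp_const a)).integrable_sq
    calc _ = ∑' k : ℕ, ENNReal.ofReal (((∫ y, f y ∂sqrtGammaMeasure k) - a) ^ 2) *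
            ENNReal.ofReal (Real.exp (-r) * r ^ k / k.factorial) := by
          rw [lintegral_countable']
          simp only [poissonMeasure_singleton]
      _ ≤ ∑' k : ℕ, ENNReal.ofReal (Real.exp (-r) * r ^ k / k.factorial) *
            ∫⁻ y, ENNReal.ofReal ((f y - a) ^ 2) ∂sqrtGammaMeasure k := by
          refine ENNReal.tsum_le_tsum fun k => ?_
          rw [mul_comm]
          exact mul_le_mul_right (ofReal_sq_integral_sub_le _ (hk k) a) _
      _ = ∫⁻ y, ENNReal.ofReal ((f y - a) ^ 2) ∂symGaussian √r := by
          rw [← sum_poisson_smul_sqrtGammaMeasure, lintegral_sum_measure]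
          simp only [lintegral_smul_measure, smul_eq_mul]
      _ = _ := by
          have h0 : ∀ m, 0 ≤ ∫ y, (f y - a) ^ 2 ∂gaussianReal m 2⁻¹ := fun m =>
            integral_nonneg fun y => sq_nonneg _
          rw [symGaussian, lintegral_smul_measure, lintegral_add_measure,
            ← ofReal_integral_eq_lintegral_ofReal (hfa _)
              (Filter.Eventually.of_forall fun x => sq_nonneg _),
            ← ofReal_integral_eq_lintegral_ofReal (hfa _)
              (Filter.Eventually.of_forall fun x => sq_nonneg _),
            ← ENNReal.ofReal_add (h0 _) (h0 _), ENNReal.ofReal_mul (by norm_num),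
            ENNReal.ofReal_inv_of_pos two_pos, ENNReal.ofReal_ofNat, smul_eq_mul]
  have hmem : MemLp (fun k : ℕ => ∫ y, f y ∂sqrtGammaMeasure k) 2 (poissonMeasure r) := by
    rw [memLp_two_iff_integrable_sq (Measurable.of_discrete.aestronglyMeasurable)]
    refine ⟨Measurable.of_discrete.aestronglyMeasurable, ?_⟩
    rw [hasFiniteIntegral_iff_ofReal (Filter.Eventually.of_forall fun x => sq_nonneg _)]
    have := hsq 0
    simp only [sub_zero] at this
    exact this.trans_lt ENNReal.ofReal_lt_top
  refine ⟨hmem, ?_, fun a => ?_⟩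
  · rw [integral_poissonMeasure' (hmem.integrable one_le_two)]
    have h1 : ∫ y, f y ∂symGaussian √r
        = 2⁻¹ * (∫ y, f y ∂gaussianReal (√r) 2⁻¹ + ∫ y, f y ∂gaussianReal (-√r) 2⁻¹) := by
      rw [symGaussian, integral_smul_measure, integral_add_measure
        ((hf _).integrable one_le_two) ((hf _).integrable one_le_two)]
      simp
    have hIntegrable : Integrable f (symGaussian √r) := by
      rw [symGaussian]
      exact (((hf _).integrable one_le_two).add_measure
        ((hf _).integrable one_le_two)).smul_measure (by simp)
    rw [← h1, ← sum_poisson_smul_sqrtGammaMeasure, integral_sum_measure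
      (by rwa [sum_poisson_smul_sqrtGammaMeasure])]
    refine tsum_congr fun k => ?_
    rw [integral_smul_measure, ENNReal.toReal_ofReal (by positivity)]
  · have h := hsq a
    have hi : Integrable (fun k : ℕ => ((∫ y, f y ∂sqrtGammaMeasure k) - a) ^ 2)
        (poissonMeasure r) := (hmem.sub (memLp_const a)).integrable_sq
    rw [← ofReal_integral_eq_lintegral_ofReal hi
      (Filter.Eventually.of_forall fun x => sq_nonneg _)] at h
    refine (ENNReal.ofReal_le_ofReal_iff ?_).1 h
    exact mul_nonneg (by norm_num) (add_nonneg (integral_nonneg fun y => sq_nonneg _)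
      (integral_nonneg fun y => sq_nonneg _))

lemma integral_cos_gaussianReal (m s : ℝ) :
    ∫ y, Real.cos (y * s) ∂gaussianReal m 2⁻¹ = Real.exp (-(s ^ 2 / 4)) * Real.cos (m * s) := by
  have h := charFun_gaussianReal (μ := m) (v := 2⁻¹) s
  rw [charFun_apply_real] at h
  have h2 := congrArg Complex.re h
  have hIntegrable : Integrable (fun y : ℝ => Complex.exp (s * y * Complex.I)) (gaussianReal m 2⁻¹) := by
    refine Integrable.of_bound (C := 1) (by fun_prop) (Filter.Eventually.of_forall fun y => ?_)
    have : (s * y * Complex.I : ℂ) = ((s * y : ℝ) : ℂ) * Complex.I := by push_cast; ring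
    rw [this, Complex.norm_exp_ofReal_mul_I]
  have h3 : (∫ y, Complex.exp (s * y * Complex.I) ∂gaussianReal m 2⁻¹).re
      = ∫ y, (Complex.exp (s * y * Complex.I)).re ∂gaussianReal m 2⁻¹ := by
    exact (Complex.reCLM.integral_comp_comm hIntegrable).symm
  rw [h3] at h2
  convert! h2 using 1
  · refine integral_congr_ae (Filter.Eventually.of_forall fun y => ?_)
    simp only [Complex.exp_re]
    simp [mul_comm]
  · rw [Complex.exp_re]
    simp [← Complex.ofReal_pow, mul_comm]
    ring_nf
    simp

/-- Fubini for a kernel dominated by a product. -/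
lemma integral_integral_swap_of_le_mul {μ ν : Measure ℝ} [SFinite μ] [SFinite ν]
    {H : ℝ → ℝ → ℝ} {a b : ℝ → ℝ} (hH : Measurable (Function.uncurry H))
    (ha : Integrable a μ) (hb : Integrable b ν) (hle : ∀ y s, |H y s| ≤ a y * b s) :
    Integrable (fun y => ∫ s, H y s ∂ν) μ ∧
    ∫ y, ∫ s, H y s ∂ν ∂μ = ∫ s, ∫ y, H y s ∂μ ∂ν := by
  have hI : Integrable (Function.uncurry H) (μ.prod ν) :=
    (ha.mul_prod hb).mono' hH.aestronglyMeasurable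
      (Filter.Eventually.of_forall fun z => hle z.1 z.2)
  exact ⟨hI.integral_prod_left, integral_integral_swap hI⟩

lemma integrableOn_min_sq_mul_rpow {p : ℝ} (hp : 0 < p) (hp2 : p < 2) :
    IntegrableOn (fun s : ℝ => |min 2 (s ^ 2) * s ^ (-1 - p)|) (Ioi 0) := by
  refine Integrable.abs ?_
  refine integrableOn_mul_rpow_of_le (φ := fun t => min 2 (t ^ 2)) hp hp2 (by fun_prop)
    (fun t _ => by positivity) (fun t _ => min_le_left _ _) (fun t _ => ?_)
  rw [Real.rpow_two]; exact min_le_right _ _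

lemma integrable_sq_gaussianReal (m : ℝ) : Integrable (fun y => y ^ 2) (gaussianReal m 2⁻¹) :=
  (memLp_id_gaussianReal' (μ := m) (v := 2⁻¹) 2 (by simp)).integrable_sq

lemma integrableOn_one_sub_exp_mul_rpow {p : ℝ} (hp : 0 < p) (hp2 : p < 2) :
    IntegrableOn (fun s : ℝ => (1 - Real.exp (-(s ^ 2 / 4))) * s ^ (-1 - p)) (Ioi 0) := by
  refine integrableOn_mul_rpow_of_le (φ := fun t => 1 - Real.exp (-(t ^ 2 / 4))) hp hp2
    (by fun_prop)
    (fun t _ => ?_) (fun t _ => ?_) (fun t _ => ?_)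
  · have := Real.exp_le_one_iff.2 (show -(t ^ 2 / 4) ≤ 0 by nlinarith [sq_nonneg t]); linarith
  · have := Real.exp_pos (-(t ^ 2 / 4)); linarith
  · have := Real.add_one_le_exp (-(t ^ 2 / 4)); rw [Real.rpow_two]; nlinarith [sq_nonneg t]

lemma integral_abs_rpow_gaussianReal {p c : ℝ} (hp : 0 < p) (hp2 : p < 2)
    (hc : ∀ x : ℝ, |x| ^ p = c * ∫ s in Ioi (0 : ℝ), (1 - Real.cos (x * s)) * s ^ (-1 - p))
    (m : ℝ) :
    Integrable (fun y => |y| ^ p) (gaussianReal m 2⁻¹) ∧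
    ∫ y, |y| ^ p ∂gaussianReal m 2⁻¹
      = c * ∫ s in Ioi (0 : ℝ), (1 - Real.exp (-(s ^ 2 / 4)) * Real.cos (m * s)) * s ^ (-1 - p)
      := by
  have h := integral_integral_swap_of_le_mul (μ := gaussianReal m 2⁻¹)
    (ν := volume.restrict (Ioi 0)) (H := fun y s => (1 - Real.cos (y * s)) * s ^ (-1 - p))
    (a := fun y => 1 + y ^ 2) (b := fun s : ℝ => |min 2 (s ^ 2) * s ^ (-1 - p)|)
    (by unfold Function.uncurry; fun_prop)
    ((integrable_const 1).add (integrable_sq_gaussianReal m))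
    (integrableOn_min_sq_mul_rpow hp hp2) (fun y s => by
      rw [abs_mul, abs_mul, ← mul_assoc]
      refine mul_le_mul_of_nonneg_right ?_ (abs_nonneg _)
      have h1 := Real.cos_le_one (y * s)
      have h2 := Real.neg_one_le_cos (y * s)
      have h3 := Real.one_sub_sq_div_two_le_cos (x := y * s)
      have h4 : 0 ≤ (min 2 (s ^ 2) : ℝ) := by positivity
      rw [abs_of_nonneg (by linarith), abs_of_nonneg h4]
      rcases min_cases (2 : ℝ) (s ^ 2) with ⟨h, _⟩ | ⟨h, _⟩ <;> rw [h]
      · nlinarith [sq_nonneg y]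
      · nlinarith [sq_nonneg y, sq_nonneg s, mul_nonneg (sq_nonneg y) (sq_nonneg s)])
  simp_rw [hc]
  refine ⟨h.1.const_mul c, ?_⟩
  rw [integral_const_mul, h.2]
  congr 1
  refine integral_congr_ae (Filter.Eventually.of_forall fun s => ?_)
  simp only
  rw [integral_mul_const, integral_sub (integrable_const 1), integral_cos_gaussianReal]
  · simp
  · refine Integrable.of_bound (C := 1) (by fun_prop) (Filter.Eventually.of_forall fun y => ?_)
    exact Real.abs_cos_le_one _

/-- The oscillatory correction to `|y| ^ p` that removes the bias at frequencies up to `T`. -/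
noncomputable def cosCorrection (p T y : ℝ) : ℝ :=
  ∫ s in Ioc 0 T, (Real.exp (s ^ 2 / 4) - 1) * s ^ (-1 - p) * Real.cos (y * s)

lemma integrableOn_exp_sub_one_mul_rpow {p : ℝ} (hp : 0 < p) (hp2 : p < 2) (T : ℝ) :
    IntegrableOn (fun s : ℝ => (Real.exp (s ^ 2 / 4) - 1) * s ^ (-1 - p)) (Ioc 0 T) ∧
    ∫ s in Ioc 0 T, |(Real.exp (s ^ 2 / 4) - 1) * s ^ (-1 - p)| ≤ Real.exp (T ^ 2 / 4) *
      ∫ s in Ioi (0 : ℝ), (1 - Real.exp (-(s ^ 2 / 4))) * s ^ (-1 - p) := by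
  have hI := integrableOn_one_sub_exp_mul_rpow hp hp2
  have hI' : IntegrableOn (fun s : ℝ => Real.exp (T ^ 2 / 4) *
      ((1 - Real.exp (-(s ^ 2 / 4))) * s ^ (-1 - p))) (Ioi 0) := Integrable.const_mul hI _
  have hI2 := hI'.mono_set (Ioc_subset_Ioi_self : Ioc 0 T ⊆ Ioi 0)
  have hnn : ∀ s : ℝ, 0 ≤ 1 - Real.exp (-(s ^ 2 / 4)) := fun s => by
    have := Real.exp_le_one_iff.2 (show -(s ^ 2 / 4) ≤ 0 by nlinarith [sq_nonneg s]); linarith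
  have hle : ∀ s ∈ Ioc 0 T, |(Real.exp (s ^ 2 / 4) - 1) * s ^ (-1 - p)| ≤ Real.exp (T ^ 2 / 4) *
      ((1 - Real.exp (-(s ^ 2 / 4))) * s ^ (-1 - p)) := fun s hs => by
    have h1 : Real.exp (s ^ 2 / 4) - 1 = Real.exp (s ^ 2 / 4) * (1 - Real.exp (-(s ^ 2 / 4))) := by
      rw [mul_sub, ← Real.exp_add]; simp
    have h2 := Real.rpow_nonneg hs.1.le (-1 - p)
    rw [h1, mul_assoc, abs_of_nonneg (mul_nonneg (Real.exp_pos _).le (mul_nonneg (hnn s) h2))]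
    refine mul_le_mul_of_nonneg_right (Real.exp_le_exp.2 ?_) (mul_nonneg (hnn s) h2)
    have := pow_le_pow_left₀ hs.1.le hs.2 2
    linarith
  have hIntegrable : IntegrableOn (fun s : ℝ => (Real.exp (s ^ 2 / 4) - 1) * s ^ (-1 - p)) (Ioc 0 T) :=
    Integrable.mono' hI2 (Measurable.aestronglyMeasurable (by fun_prop))
      ((ae_restrict_iff' measurableSet_Ioc).2 (Filter.Eventually.of_forall hle))
  refine ⟨hIntegrable, ?_⟩
  rw [← integral_const_mul]
  refine (setIntegral_mono_on hIntegrable.abs hI2 measurableSet_Ioc hle).trans ?_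
  refine setIntegral_mono_set hI' ?_ (LE.le.eventuallyLE Ioc_subset_Ioi_self)
  refine (ae_restrict_iff' measurableSet_Ioi).2 (Filter.Eventually.of_forall fun s hs => ?_)
  exact mul_nonneg (Real.exp_pos _).le (mul_nonneg (hnn s) (Real.rpow_nonneg (le_of_lt hs) _))

lemma cosCorrection_gaussianReal {p : ℝ} (hp : 0 < p) (hp2 : p < 2) (T m : ℝ) :
    Integrable (cosCorrection p T) (gaussianReal m 2⁻¹) ∧
    ∫ y, cosCorrection p T y ∂gaussianReal m 2⁻¹ =
      ∫ s in Ioc 0 T, (1 - Real.exp (-(s ^ 2 / 4))) * s ^ (-1 - p) * Real.cos (m * s) := by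
  have h := integral_integral_swap_of_le_mul (μ := gaussianReal m 2⁻¹)
    (ν := volume.restrict (Ioc 0 T))
    (H := fun y s => (Real.exp (s ^ 2 / 4) - 1) * s ^ (-1 - p) * Real.cos (y * s))
    (a := fun y => 1) (b := fun s : ℝ => |(Real.exp (s ^ 2 / 4) - 1) * s ^ (-1 - p)|)
    (by unfold Function.uncurry; fun_prop) (integrable_const 1)
    (integrableOn_exp_sub_one_mul_rpow hp hp2 T).1.abs (fun y s => by
      rw [abs_mul, one_mul]
      exact mul_le_of_le_one_right (abs_nonneg _) (Real.abs_cos_le_one _))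
  refine ⟨h.1, ?_⟩
  unfold cosCorrection
  rw [h.2]
  refine integral_congr_ae (Filter.Eventually.of_forall fun s => ?_)
  simp only
  rw [integral_const_mul, integral_cos_gaussianReal]
  have : 1 - Real.exp (-(s ^ 2 / 4)) = (Real.exp (s ^ 2 / 4) - 1) * Real.exp (-(s ^ 2 / 4)) := by
    rw [sub_mul, ← Real.exp_add]; simp
  rw [this]; ring

lemma abs_cosCorrection_le {p : ℝ} (hp : 0 < p) (hp2 : p < 2) (T y : ℝ) :
    |cosCorrection p T y| ≤ Real.exp (T ^ 2 / 4) *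
      ∫ s in Ioi (0 : ℝ), (1 - Real.exp (-(s ^ 2 / 4))) * s ^ (-1 - p) := by
  have h := integrableOn_exp_sub_one_mul_rpow hp hp2 T
  refine (norm_integral_le_of_norm_le (f := fun s => (Real.exp (s ^ 2 / 4) - 1) * s ^ (-1 - p) *
    Real.cos (y * s)) h.1.abs (Filter.Eventually.of_forall fun s => ?_)).trans h.2
  rw [Real.norm_eq_abs, abs_mul]
  exact mul_le_of_le_one_right (abs_nonneg _) (Real.abs_cos_le_one _)

/-- Bias of the corrected estimator. -/
lemma abs_integral_sub_cosCorrection_le {p c : ℝ} (hp : 0 < p) (hp2 : p < 2) (hc0 : 0 < c)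
    (hcI : ∀ x : ℝ, IntegrableOn (fun s : ℝ => (1 - Real.cos (x * s)) * s ^ (-1 - p)) (Ioi 0))
    (hc : ∀ x : ℝ, |x| ^ p = c * ∫ s in Ioi (0 : ℝ), (1 - Real.cos (x * s)) * s ^ (-1 - p))
    (m : ℝ) {T : ℝ} (hT : 0 < T) :
    |∫ y, (|y| ^ p - c * cosCorrection p T y) ∂gaussianReal m 2⁻¹ - |m| ^ p|
      ≤ c / p * T ^ (-p) := by
  have h1 := integral_abs_rpow_gaussianReal hp hp2 hc m
  have h2 := cosCorrection_gaussianReal hp hp2 T m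
  have hρ : IntegrableOn (fun s : ℝ => (1 - Real.exp (-(s ^ 2 / 4))) * s ^ (-1 - p)
      * Real.cos (m * s)) (Ioi 0) := by
    refine Integrable.mono' (integrableOn_one_sub_exp_mul_rpow hp hp2).abs
      (Measurable.aestronglyMeasurable (by fun_prop)) (Filter.Eventually.of_forall fun s => ?_)
    rw [Real.norm_eq_abs, abs_mul]
    exact mul_le_of_le_one_right (abs_nonneg _) (Real.abs_cos_le_one _)
  have hsplit : ∫ s in Ioi (0 : ℝ), (1 - Real.exp (-(s ^ 2 / 4)) * Real.cos (m * s)) * s ^ (-1 - p)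
      = (∫ s in Ioi (0 : ℝ), (1 - Real.cos (m * s)) * s ^ (-1 - p))
        + ((∫ s in Ioc 0 T, (1 - Real.exp (-(s ^ 2 / 4))) * s ^ (-1 - p) * Real.cos (m * s))
        + ∫ s in Ioi T, (1 - Real.exp (-(s ^ 2 / 4))) * s ^ (-1 - p) * Real.cos (m * s)) := by
    rw [← setIntegral_union (Ioc_disjoint_Ioi le_rfl) measurableSet_Ioi
      (hρ.mono_set Ioc_subset_Ioi_self) (hρ.mono_set (Ioi_subset_Ioi hT.le)),
      Ioc_union_Ioi_eq_Ioi hT.le, ← integral_add (hcI m) hρ]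
    refine integral_congr_ae (Filter.Eventually.of_forall fun s => ?_)
    simp only; ring
  rw [integral_sub h1.1 (h2.1.const_mul c), integral_const_mul, h1.2, h2.2, hsplit, hc m]
  have htail : |∫ s in Ioi T, (1 - Real.exp (-(s ^ 2 / 4))) * s ^ (-1 - p) * Real.cos (m * s)|
      ≤ T ^ (-p) / p := by
    have hI := integrableOn_Ioi_rpow_of_lt (show -1 - p < -1 by linarith) hT
    have := integral_Ioi_rpow_of_lt (show -1 - p < -1 by linarith) hT
    have h3 : T ^ (-p) / p = ∫ s in Ioi T, s ^ (-1 - p) := by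
      rw [this, show -1 - p + 1 = -p by ring]; field_simp
    rw [h3]
    refine norm_integral_le_of_norm_le (f := fun s => (1 - Real.exp (-(s ^ 2 / 4))) *
      s ^ (-1 - p) * Real.cos (m * s)) hI
      ((ae_restrict_iff' measurableSet_Ioi).2 (Filter.Eventually.of_forall fun s hs => ?_))
    have hs0 : (0:ℝ) < s := hT.trans hs
    have h4 := Real.exp_le_one_iff.2 (show -(s ^ 2 / 4) ≤ 0 by nlinarith [sq_nonneg s])
    have h5 := Real.exp_pos (-(s ^ 2 / 4))
    have h6 := Real.rpow_nonneg hs0.le (-1 - p)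
    rw [Real.norm_eq_abs, abs_mul, abs_mul, abs_of_nonneg h6, abs_of_nonneg (by linarith)]
    calc _ ≤ 1 * s ^ (-1 - p) * 1 := by
          gcongr
          · linarith
          · exact Real.abs_cos_le_one _
      _ = _ := by ring
  calc _ = c * |∫ s in Ioi T, (1 - Real.exp (-(s ^ 2 / 4))) * s ^ (-1 - p) * Real.cos (m * s)| := by
        rw [← abs_of_pos hc0, ← abs_mul, abs_of_pos hc0]; congr 1; ring
    _ ≤ c * (T ^ (-p) / p) := by gcongr
    _ = _ := by ring

lemma rpow_sub_rpow_le {p u v : ℝ} (hp : 1 ≤ p) (hu : 0 ≤ u) (huv : u ≤ v) :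
    v ^ p - u ^ p ≤ p * v ^ (p - 1) * (v - u) := by
  rcases (hu.trans huv).eq_or_lt with hv | hv
  · have : u = 0 := le_antisymm (hv ▸ huv) hu
    subst this; subst hv; simp
  have h := one_add_mul_self_le_rpow_one_add (s := u / v - 1)
    (by have := div_nonneg hu hv.le; linarith) hp
  rw [add_sub_cancel, Real.div_rpow hu hv.le] at h
  have hvp : 0 < v ^ p := Real.rpow_pos_of_pos hv p
  have h1 := mul_le_mul_of_nonneg_right h hvp.le
  rw [div_mul_cancel₀ _ hvp.ne'] at h1
  have h2 : v ^ p = v ^ (p - 1) * v := by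
    rw [Real.rpow_sub_one hv.ne']; field_simp
  have h3 : (1 + p * (u / v - 1)) * v ^ p = v ^ p - p * v ^ (p - 1) * (v - u) := by
    rw [h2]; field_simp; ring
  linarith

lemma sq_abs_rpow_sub_le {p : ℝ} (hp1 : 1 ≤ p) (hp2 : p ≤ 2) (y m : ℝ) :
    (|y| ^ p - |m| ^ p) ^ 2 ≤ 8 * |m| ^ (2 * p - 2) * (y - m) ^ 2
      + 8 * ((y - m) ^ 2 + (y - m) ^ 4) := by
  set d := |y - m| with hd
  have hd0 : 0 ≤ d := abs_nonneg _
  have hm0 := abs_nonneg m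
  have hy0 := abs_nonneg y
  have hdiff : |(|y| - |m|)| ≤ d := abs_abs_sub_abs_le_abs_sub y m
  have hbase : ∀ u v : ℝ, 0 ≤ u → u ≤ v → v ≤ |m| + d → v - u ≤ d →
      v ^ p - u ^ p ≤ 2 * (|m| ^ (p - 1) + d ^ (p - 1)) * d := fun u v hu huv hv hvu => by
    refine (rpow_sub_rpow_le hp1 hu huv).trans ?_
    have h1 : v ^ (p - 1) ≤ |m| ^ (p - 1) + d ^ (p - 1) :=
      (Real.rpow_le_rpow (hu.trans huv) hv (by linarith)).trans
        (Real.rpow_add_le_add_rpow hm0 hd0 (by linarith) (by linarith))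
    have h2 : 0 ≤ v ^ (p - 1) := Real.rpow_nonneg (hu.trans huv) _
    gcongr
  have habs : |(|y| ^ p - |m| ^ p)| ≤ 2 * (|m| ^ (p - 1) + d ^ (p - 1)) * d := by
    rw [abs_le] at hdiff
    rcases le_total (|m|) (|y|) with h | h
    · rw [abs_of_nonneg (sub_nonneg.2 (Real.rpow_le_rpow hm0 h (by linarith)))]
      exact hbase _ _ hm0 h (by linarith) (by linarith)
    · rw [abs_sub_comm, abs_of_nonneg (sub_nonneg.2 (Real.rpow_le_rpow hy0 h (by linarith)))]
      exact hbase _ _ hy0 h (by linarith) (by linarith)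
  have hsq : ∀ x : ℝ, 0 ≤ x → (x ^ (p - 1)) ^ 2 = x ^ (2 * p - 2) := fun x hx => by
    rw [← Real.rpow_natCast, ← Real.rpow_mul hx]; congr 1; push_cast; ring
  have hd2 : (y - m) ^ 2 = d ^ 2 := by rw [hd, sq_abs]
  have hd4 : (y - m) ^ 4 = d ^ 2 * d ^ 2 := by rw [← hd2]; ring
  have hdp : d ^ (2 * p - 2) ≤ 1 + d ^ 2 := by
    rcases le_total d 1 with h | h
    · have := Real.rpow_le_one hd0 h (show 0 ≤ 2 * p - 2 by linarith)
      nlinarith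
    · have := Real.rpow_le_rpow_of_exponent_le h (show 2 * p - 2 ≤ 2 by linarith)
      rw [Real.rpow_two] at this; linarith
  rw [← sq_abs]
  refine (pow_le_pow_left₀ (abs_nonneg _) habs 2).trans ?_
  rw [hd4, hd2, mul_pow, mul_pow, ← hsq _ hm0]
  rw [← hsq _ hd0] at hdp
  nlinarith [sq_nonneg (|m| ^ (p - 1) - d ^ (p - 1)), sq_nonneg d,
    mul_nonneg (sq_nonneg (|m| ^ (p - 1) - d ^ (p - 1))) (sq_nonneg d),
    mul_nonneg (sq_nonneg d) (sub_nonneg.2 hdp)]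

lemma integrable_pow_gaussianReal (k : ℕ) (m : ℝ) :
    Integrable (fun y => (y - m) ^ k) (gaussianReal m 2⁻¹) ∧
    ∫ y, (y - m) ^ k ∂gaussianReal m 2⁻¹ = ∫ y, y ^ k ∂gaussianReal 0 2⁻¹ := by
  have hmap : gaussianReal m 2⁻¹ = (gaussianReal 0 2⁻¹).map (· + m) := by
    rw [gaussianReal_map_add_const, zero_add]
  have h0 : Integrable (fun y : ℝ => y ^ k) (gaussianReal 0 2⁻¹) := by
    rcases Nat.eq_zero_or_pos k with rfl | hk
    · simp
    · have h1 : MemLp id (k : ℝ≥0∞) (gaussianReal 0 2⁻¹) :=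
        memLp_id_gaussianReal' (μ := 0) (v := 2⁻¹) k (by simp)
      have h2 := h1.integrable_norm_pow hk.ne'
      refine (integrable_norm_iff (by fun_prop)).1 ?_
      simpa using h2
  rw [hmap]
  have he : MeasurableEmbedding (fun x : ℝ => x + m) := measurableEmbedding_addRight m
  constructor
  · rw [he.integrable_map_iff]
    simpa [Function.comp_def] using h0
  · rw [he.integral_map]
    simp

/-- Poisson estimators of `lam ^ α` with trade-off parameter `T` between bias and variance. -/
lemma exists_poisson_estimator {α : ℝ} (hα0 : 1 / 2 < α) (hα : α < 1) :
    ∃ C : ℝ, 0 < C ∧ ∀ T : ℝ, 0 < T → ∃ g : ℕ → ℝ, ∀ r : ℝ≥0,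
      MemLp g 2 (poissonMeasure r) ∧
      |∫ k, g k ∂poissonMeasure r - (r : ℝ) ^ α| ≤ C * T ^ (-(2 * α)) ∧
      ∫ k, (g k - (r : ℝ) ^ α) ^ 2 ∂poissonMeasure r
        ≤ C * (1 + (r : ℝ) ^ (2 * α - 1) + Real.exp (T ^ 2 / 2)) := by
  set p := 2 * α with hp
  have hp0 : 0 < p := by linarith
  have hp1 : 1 ≤ p := by linarith
  have hp2 : p < 2 := by linarith
  obtain ⟨c, hc0, hc⟩ := exists_abs_rpow_eq_integral_cos hp0 hp2
  set I := ∫ s in Ioi (0 : ℝ), (1 - Real.exp (-(s ^ 2 / 4))) * s ^ (-1 - p) with hI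
  set M2 := ∫ y, y ^ 2 ∂gaussianReal 0 2⁻¹ with hM2
  set M4 := ∫ y, y ^ 4 ∂gaussianReal 0 2⁻¹ with hM4
  have hM2n : 0 ≤ M2 := integral_nonneg fun y => by positivity
  have hM4n : 0 ≤ M4 := integral_nonneg fun y => by positivity
  refine ⟨c / p + 16 * M2 + 16 * M4 + 2 * c ^ 2 * I ^ 2, by positivity, fun T hT => ?_⟩
  set f : ℝ → ℝ := fun y => |y| ^ p - c * cosCorrection p T y with hf
  have hbound : ∀ m y, (f y - |m| ^ p) ^ 2 ≤ 16 * |m| ^ (2 * p - 2) * (y - m) ^ 2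
      + 16 * ((y - m) ^ 2 + (y - m) ^ 4) + 2 * c ^ 2 * I ^ 2 * Real.exp (T ^ 2 / 2) := fun m y => by
    have h1 := sq_abs_rpow_sub_le hp1 hp2.le y m
    have h2 := pow_le_pow_left₀ (abs_nonneg _) (abs_cosCorrection_le hp0 hp2 T y) 2
    rw [sq_abs, mul_pow, ← hI, ← Real.exp_nat_mul] at h2
    have h3 : ((2 : ℕ) : ℝ) * (T ^ 2 / 4) = T ^ 2 / 2 := by push_cast; ring
    rw [h3] at h2
    have h4 := mul_le_mul_of_nonneg_left h2 (sq_nonneg c)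
    have h5 : f y - |m| ^ p = (|y| ^ p - |m| ^ p) - c * cosCorrection p T y := by
      simp only [hf]; ring
    rw [h5]
    nlinarith [sq_nonneg ((|y| ^ p - |m| ^ p) + c * cosCorrection p T y)]
  have hdom : ∀ m, Integrable (fun y => 16 * |m| ^ (2 * p - 2) * (y - m) ^ 2
      + 16 * ((y - m) ^ 2 + (y - m) ^ 4) + 2 * c ^ 2 * I ^ 2 * Real.exp (T ^ 2 / 2))
      (gaussianReal m 2⁻¹) := fun m =>
    (((integrable_pow_gaussianReal 2 m).1.const_mul _).add
      (((integrable_pow_gaussianReal 2 m).1.add (integrable_pow_gaussianReal 4 m).1).const_mul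
        _)).add (integrable_const _)
  have hfm : ∀ m, AEStronglyMeasurable f (gaussianReal m 2⁻¹) := fun m =>
    ((integral_abs_rpow_gaussianReal hp0 hp2 (fun x => (hc x).2) m).1.sub
      ((cosCorrection_gaussianReal hp0 hp2 T m).1.const_mul c)).1
  have hLp' : ∀ m, Integrable (fun y => (f y - |m| ^ p) ^ 2) (gaussianReal m 2⁻¹) := fun m =>
    (hdom m).mono' (((hfm m).sub aestronglyMeasurable_const).pow 2)
      (Filter.Eventually.of_forall fun y => by
        rw [Real.norm_of_nonneg (sq_nonneg _)]; exact hbound m y)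
  have hLp : ∀ m, MemLp f 2 (gaussianReal m 2⁻¹) := fun m => by
    have h1 : MemLp (fun y => f y - |m| ^ p) 2 (gaussianReal m 2⁻¹) :=
      (memLp_two_iff_integrable_sq ((hfm m).sub aestronglyMeasurable_const)).2 (hLp' m)
    have h2 := MemLp.add h1 (memLp_const (μ := gaussianReal m 2⁻¹) (p := 2) (|m| ^ p))
    refine h2.ae_eq (Filter.Eventually.of_forall fun y => ?_)
    simp
  have hmse : ∀ m, ∫ y, (f y - |m| ^ p) ^ 2 ∂gaussianReal m 2⁻¹ ≤
      16 * |m| ^ (2 * p - 2) * M2 + 16 * (M2 + M4)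
        + 2 * c ^ 2 * I ^ 2 * Real.exp (T ^ 2 / 2) := fun m => by
    refine (integral_mono (hLp' m) (hdom m) (hbound m)).trans_eq ?_
    have i2 := integrable_pow_gaussianReal 2 m
    have i4 := integrable_pow_gaussianReal 4 m
    have i24 : Integrable (fun y => (y - m) ^ 2 + (y - m) ^ 4) (gaussianReal m 2⁻¹) :=
      i2.1.add i4.1
    have isum : Integrable (fun y => 16 * |m| ^ (2 * p - 2) * (y - m) ^ 2
      + 16 * ((y - m) ^ 2 + (y - m) ^ 4)) (gaussianReal m 2⁻¹) :=
      (i2.1.const_mul _).add (i24.const_mul _)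
    rw [integral_add isum (integrable_const _),
      integral_add (i2.1.const_mul _) (i24.const_mul _), integral_const_mul,
      integral_const_mul, integral_add i2.1 i4.1, i2.2, i4.2, ← hM2, ← hM4]
    simp
  refine ⟨fun k => ∫ y, f y ∂sqrtGammaMeasure k, fun r => ?_⟩
  obtain ⟨k1, k2, k3⟩ := integral_poissonMeasure_of_symGaussian r hLp
  have hr0 : (0 : ℝ) ≤ r := r.2
  have hpow : ∀ q : ℝ, |√(r : ℝ)| ^ (2 * q) = (r : ℝ) ^ q := fun q => by
    rw [abs_of_nonneg (Real.sqrt_nonneg _), Real.rpow_mul (Real.sqrt_nonneg _), Real.rpow_two,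
      Real.sq_sqrt hr0]
  have hsα : |√(r : ℝ)| ^ p = (r : ℝ) ^ α := hpow α
  have hsα' : |-√(r : ℝ)| ^ p = (r : ℝ) ^ α := by rw [abs_neg, hsα]
  have hs2 : |√(r : ℝ)| ^ (2 * p - 2) = (r : ℝ) ^ (p - 1) := by rw [← hpow]; congr 1; ring
  refine ⟨k1, ?_, ?_⟩
  · have b1 := abs_integral_sub_cosCorrection_le hp0 hp2 hc0 (fun x => (hc x).1)
      (fun x => (hc x).2) (√r) hT
    have b2 := abs_integral_sub_cosCorrection_le hp0 hp2 hc0 (fun x => (hc x).1)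
      (fun x => (hc x).2) (-√r) hT
    rw [hsα] at b1
    rw [hsα'] at b2
    rw [k2]
    have hTp : 0 ≤ T ^ (-p) := Real.rpow_nonneg hT.le _
    have : c / p * T ^ (-p) ≤ (c / p + 16 * M2 + 16 * M4 + 2 * c ^ 2 * I ^ 2) * T ^ (-p) := by
      apply mul_le_mul_of_nonneg_right _ hTp
      nlinarith [mul_nonneg (sq_nonneg c) (sq_nonneg I)]
    rw [abs_le] at b1 b2 ⊢
    constructor <;> linarith [b1.1, b1.2, b2.1, b2.2]
  · refine (k3 _).trans ?_
    have b1 := hmse (√r)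
    have b2 := hmse (-√r)
    rw [hsα, hs2] at b1
    rw [hsα', abs_neg, hs2] at b2
    have hrp : 0 ≤ (r : ℝ) ^ (p - 1) := Real.rpow_nonneg hr0 _
    have he := Real.exp_pos (T ^ 2 / 2)
    have hcp : 0 ≤ c / p := by positivity
    have hcI : 0 ≤ 2 * c ^ 2 * I ^ 2 := by positivity
    have : 16 * (r : ℝ) ^ (p - 1) * M2 + 16 * (M2 + M4)
        + 2 * c ^ 2 * I ^ 2 * Real.exp (T ^ 2 / 2) ≤
        (c / p + 16 * M2 + 16 * M4 + 2 * c ^ 2 * I ^ 2) *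
          (1 + (r : ℝ) ^ (p - 1) + Real.exp (T ^ 2 / 2)) := by
      have := mul_nonneg hM2n hrp
      have := mul_nonneg hM4n hrp
      have := mul_nonneg hM2n he.le
      have := mul_nonneg hM4n he.le
      have := mul_nonneg hcp hrp
      have := mul_nonneg hcp he.le
      have := mul_nonneg hcI hrp
      nlinarith
    linarith

lemma poissonRisk_eq_lintegral {S : ℕ} {lam : ℝ} {P : Fin S → ℝ} (hP : ∀ i, 0 ≤ lam * P i)
    (t : ℝ) (est : (Fin S → ℕ) → ℝ) :
    poissonRisk S lam P t est = ∫⁻ z, ENNReal.ofReal ((est z - t) ^ 2)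
      ∂Measure.pi (fun i => poissonMeasure (lam * P i).toNNReal) := by
  rw [poissonRisk, lintegral_countable']
  refine tsum_congr fun z => ?_
  rw [Measure.pi_singleton, mul_comm, ENNReal.ofReal_mul (sq_nonneg _), poissonPMF,
    ENNReal.ofReal_prod_of_nonneg]
  · congr 1
    refine Finset.prod_congr rfl fun i _ => ?_
    rw [poissonMeasure_singleton, Real.coe_toNNReal _ (hP i)]
  · intro i _
    have := hP i
    positivity

lemma integral_sq_sum_pi_le {ι : Type*} [Fintype ι] {μ : ι → Measure ℕ}
    [∀ i, IsProbabilityMeasure (μ i)] {h : ι → ℕ → ℝ} (hh : ∀ i, MemLp (h i) 2 (μ i)) :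
    MemLp (fun z : ι → ℕ => ∑ i, h i (z i)) 2 (Measure.pi μ) ∧
    ∫ z : ι → ℕ, (∑ i, h i (z i)) ^ 2 ∂Measure.pi μ
      ≤ ∑ i, ∫ k, h i k ^ 2 ∂μ i + (∑ i, ∫ k, h i k ∂μ i) ^ 2 := by
  have hpi : ∀ i, MemLp (fun z : ι → ℕ => h i (z i)) 2 (Measure.pi μ) := fun i =>
    (hh i).comp_measurePreserving (measurePreserving_eval _ i)
  have hsum : MemLp (fun z : ι → ℕ => ∑ i, h i (z i)) 2 (Measure.pi μ) :=
    memLp_finsetSum _ fun i _ => hpi i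
  refine ⟨hsum, ?_⟩
  have hvar := variance_sum_pi hh
  have hfun : (∑ i, fun z : ι → ℕ => h i (z i)) = fun z => ∑ i, h i (z i) := by
    ext z; simp
  rw [hfun, variance_eq_sub hsum] at hvar
  have hmean : ∫ z : ι → ℕ, (∑ i, h i (z i)) ∂Measure.pi μ = ∑ i, ∫ k, h i k ∂μ i := by
    rw [integral_finsetSum _ fun i _ => (hpi i).integrable (by norm_num)]
    refine Finset.sum_congr rfl fun i _ => ?_
    rw [← (measurePreserving_eval μ i).map_eq, integral_map (measurable_pi_apply i).aemeasurable
      (by fun_prop)]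
  rw [hmean] at hvar
  have hle : ∑ i, Var[h i; μ i] ≤ ∑ i, ∫ k, h i k ^ 2 ∂μ i :=
    Finset.sum_le_sum fun i _ => variance_le_expectation_sq (hh i).1
  have : ∫ z : ι → ℕ, (∑ i, h i (z i)) ^ 2 ∂Measure.pi μ
    = (Measure.pi μ)[(fun z : ι → ℕ => ∑ i, h i (z i)) ^ 2] := rfl
  rw [this]
  linarith

lemma sum_rpow_le_of_mem_simplex {S : ℕ} (hS : 0 < S) {P : Fin S → ℝ} (hP : P ∈ simplex S)
    {q : ℝ} (hq0 : 0 ≤ q) (hq1 : q ≤ 1) : ∑ i, P i ^ q ≤ (S : ℝ) ^ (1 - q) := by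
  have hS' : (0 : ℝ) < S := by exact_mod_cast hS
  have h := (Real.concaveOn_rpow hq0 hq1).le_map_sum (t := Finset.univ)
    (w := fun _ : Fin S => (S : ℝ)⁻¹) (p := P) (fun _ _ => by positivity)
    (by simp [hS'.ne']) (fun i _ => hP.1 i)
  simp only [smul_eq_mul, ← Finset.mul_sum, hP.2, mul_one] at h
  rw [Real.inv_rpow hS'.le, inv_mul_le_iff₀ hS'] at h
  rwa [Real.rpow_sub hS', Real.rpow_one]

/-- The risk bound for a sum of coordinatewise estimators. -/
lemma poissonRisk_sum_le {S : ℕ} (hS : 0 < S) {α C T n : ℝ} (hn : 0 < n) (hα0 : 1 / 2 < α)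
    (hα : α < 1) (hC : 0 < C) {g : ℕ → ℝ}
    (hg : ∀ r : ℝ≥0, MemLp g 2 (poissonMeasure r) ∧
      |∫ k, g k ∂poissonMeasure r - (r : ℝ) ^ α| ≤ C * T ^ (-(2 * α)) ∧
      ∫ k, (g k - (r : ℝ) ^ α) ^ 2 ∂poissonMeasure r
        ≤ C * (1 + (r : ℝ) ^ (2 * α - 1) + Real.exp (T ^ 2 / 2)))
    {P : Fin S → ℝ} (hP : P ∈ simplex S) :
    poissonRisk S n P (Falpha S α P) (fun z => n ^ (-α) * ∑ i, g (z i)) ≤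
      ENNReal.ofReal (n ^ (-(2 * α)) * (C * (S + n ^ (2 * α - 1) * (S : ℝ) ^ (2 - 2 * α)
        + S * Real.exp (T ^ 2 / 2)) + (S * (C * T ^ (-(2 * α)))) ^ 2)) := by
  have hnn : ∀ i, 0 ≤ n * P i := fun i => mul_nonneg hn.le (hP.1 i)
  have hcoe : ∀ i, (((n * P i).toNNReal : ℝ≥0) : ℝ) = n * P i := fun i => Real.coe_toNNReal _ (hnn i)
  set μ : Fin S → Measure ℕ := fun i => poissonMeasure (n * P i).toNNReal with hμ
  set h : Fin S → ℕ → ℝ := fun i k => g k - (n * P i) ^ α with hh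
  have hLp : ∀ i, MemLp (h i) 2 (μ i) := fun i => (hg _).1.sub (memLp_const _)
  obtain ⟨hL, hle⟩ := integral_sq_sum_pi_le hLp
  have hnα : n ^ (-α) * n ^ α = 1 := by rw [← Real.rpow_add hn]; simp
  have hest : ∀ z : Fin S → ℕ, (n ^ (-α) * ∑ i, g (z i) - Falpha S α P) ^ 2
      = n ^ (-(2 * α)) * (∑ i, h i (z i)) ^ 2 := fun z => by
    have h1 : n ^ (-(2 * α)) = (n ^ (-α)) ^ 2 := by
      rw [← Real.rpow_natCast, ← Real.rpow_mul hn.le]; congr 1; push_cast; ring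
    have h2 : Falpha S α P = n ^ (-α) * ∑ i, (n * P i) ^ α := by
      rw [Falpha, Finset.mul_sum]
      refine Finset.sum_congr rfl fun i _ => ?_
      rw [Real.mul_rpow hn.le (hP.1 i), ← mul_assoc, hnα, one_mul]
    rw [h1, h2, ← mul_pow, ← mul_sub, ← Finset.sum_sub_distrib]
  rw [poissonRisk_eq_lintegral hnn]
  simp_rw [hest]
  rw [← ofReal_integral_eq_lintegral_ofReal (hL.integrable_sq.const_mul _)
    (Filter.Eventually.of_forall fun z =>
      mul_nonneg (Real.rpow_nonneg hn.le _) (sq_nonneg _)), integral_const_mul]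
  refine ENNReal.ofReal_le_ofReal (mul_le_mul_of_nonneg_left (hle.trans ?_)
    (Real.rpow_nonneg hn.le _))
  refine add_le_add ?_ ?_
  · calc ∑ i, ∫ k, h i k ^ 2 ∂μ i
        ≤ ∑ i, C * (1 + (n * P i) ^ (2 * α - 1) + Real.exp (T ^ 2 / 2)) := by
          refine Finset.sum_le_sum fun i _ => ?_
          have := (hg (n * P i).toNNReal).2.2
          rwa [hcoe] at this
      _ = C * (S + n ^ (2 * α - 1) * ∑ i, P i ^ (2 * α - 1) + S * Real.exp (T ^ 2 / 2)) := by
          rw [← Finset.mul_sum, Finset.sum_add_distrib, Finset.sum_add_distrib, Finset.mul_sum]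
          congr 3
          · simp
          · exact Finset.sum_congr rfl fun i _ => Real.mul_rpow hn.le (hP.1 i)
          · simp
      _ ≤ _ := by
          have := sum_rpow_le_of_mem_simplex hS hP (q := 2 * α - 1) (by linarith) (by linarith)
          rw [show 1 - (2 * α - 1) = 2 - 2 * α by ring] at this
          have := Real.rpow_nonneg hn.le (2 * α - 1)
          gcongr
  · rw [← sq_abs]
    refine pow_le_pow_left₀ (abs_nonneg _) ?_ 2
    refine (Finset.abs_sum_le_sum_abs _ _).trans ?_
    calc _ ≤ ∑ i : Fin S, C * T ^ (-(2 * α)) := by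
          refine Finset.sum_le_sum fun i _ => ?_
          have := (hg (n * P i).toNNReal).2.1
          rw [hcoe] at this
          have h1 : ∫ k, h i k ∂μ i = ∫ k, g k ∂μ i - (n * P i) ^ α := by
            rw [integral_sub ((hg _).1.integrable (by norm_num)) (integrable_const _)]
            simp [hμ]
          rw [h1]; exact this
      _ = _ := by simp

/-- Under the sample size condition, the alphabet size is at most a power of `n` less than one. -/
lemma exists_le_mul_rpow_of_mul_rpow_le {α c₀ : ℝ} (hα0 : 0 < α) (hα : α < 1) (hc₀ : 0 < c₀) :
    ∃ K : ℝ, 0 < K ∧ ∀ S n : ℕ, 2 ≤ S → 2 ≤ n →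
      c₀ * (S : ℝ) ^ (1 / α) ≤ (n : ℝ) * Real.log S →
      (S : ℝ) ≤ K * (n : ℝ) ^ (2 * α / (1 + α)) := by
  set η := (1 / α - 1) / 2 with hη
  have hη0 : 0 < η := by
    have : 1 < 1 / α := by rw [lt_div_iff₀ hα0]; linarith
    rw [hη]; linarith
  refine ⟨(1 / (c₀ * η)) ^ (2 * α / (1 + α)), by positivity, fun S n hS hn h => ?_⟩
  have hS0 : (0 : ℝ) < S := by exact_mod_cast (by omega : 0 < S)
  have hlog := Real.log_le_rpow_div hS0.le hη0
  have h1 : (S : ℝ) ^ (1 / α) ≤ (1 / (c₀ * η)) * n * (S : ℝ) ^ η := by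
    have h2 : c₀ * (S : ℝ) ^ (1 / α) ≤ n * ((S : ℝ) ^ η / η) :=
      h.trans (mul_le_mul_of_nonneg_left hlog (Nat.cast_nonneg n))
    rw [← le_div_iff₀' hc₀] at h2
    refine h2.trans_eq ?_
    field_simp
  have h3 : (S : ℝ) ^ ((1 + α) / (2 * α)) ≤ (1 / (c₀ * η)) * n := by
    have h4 : (1 + α) / (2 * α) = 1 / α - η := by rw [hη]; field_simp; ring
    rw [h4, Real.rpow_sub hS0, div_le_iff₀ (Real.rpow_pos_of_pos hS0 _)]
    exact h1
  rw [← Real.mul_rpow (by positivity) (Nat.cast_nonneg n)]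
  have h5 := Real.rpow_le_rpow (Real.rpow_nonneg hS0.le _) h3
    (show 0 ≤ 2 * α / (1 + α) by positivity)
  rw [← Real.rpow_mul hS0.le] at h5
  have h6 : (1 + α) / (2 * α) * (2 * α / (1 + α)) = 1 := by field_simp
  rwa [h6, Real.rpow_one] at h5

theorem poissonMinimax_Falpha_le {α c₀ : ℝ} (hα0 : 1 / 2 < α) (hα : α < 1) (hc₀ : 0 < c₀) :
    ∃ C : ℝ, 0 < C ∧ ∀ S n : ℕ, 2 ≤ S → 2 ≤ n →
      c₀ * (S : ℝ) ^ (1 / α) ≤ (n : ℝ) * Real.log S →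
      poissonMinimax S (n : ℝ) (Falpha S α)
        ≤ ENNReal.ofReal (C * ((S : ℝ) ^ 2 / ((n : ℝ) * Real.log n) ^ (2 * α)
          + (S : ℝ) ^ (2 - 2 * α) / (n : ℝ))) := by
  obtain ⟨C, hC, hest⟩ := exists_poisson_estimator hα0 hα
  obtain ⟨K, hK, hSn⟩ := exists_le_mul_rpow_of_mul_rpow_le (by linarith) hα hc₀
  set q := 2 * α - 1 with hq
  have hq0 : 0 < q := by linarith
  set β := 2 * α / (1 + α) with hβ
  have hβ1 : β < 1 := by rw [hβ, div_lt_one (by linarith)]; linarith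
  set κ := 2 * ((1 - β) * q) with hκ
  have hκ0 : 0 < κ := by have : 0 < 1 - β := by linarith
                         positivity
  refine ⟨C * (1 + 2 * K ^ q) + C ^ 2 * κ ^ (-(2 * α)), by positivity,
    fun S n hS hn hyp => ?_⟩
  have hS0 : (0 : ℝ) < S := by exact_mod_cast (by omega : 0 < S)
  have hn1 : (1 : ℝ) < n := by exact_mod_cast (by omega : 1 < n)
  have hn0 : (0 : ℝ) < n := by linarith
  have hL : 0 < Real.log n := Real.log_pos hn1
  set T := √(κ * Real.log n) with hT
  have hTpos : 0 < T := Real.sqrt_pos.2 (by positivity)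
  have hT2 : T ^ 2 = κ * Real.log n := Real.sq_sqrt (by positivity)
  obtain ⟨g, hg⟩ := hest T hTpos
  refine (iInf_le _ (fun z => (n : ℝ) ^ (-α) * ∑ i, g (z i))).trans ?_
  refine iSup₂_le fun P hP => ?_
  refine (poissonRisk_sum_le (by omega) hn0 hα0 hα hC hg hP).trans ?_
  refine ENNReal.ofReal_le_ofReal ?_
  have hexp : Real.exp (T ^ 2 / 2) = (n : ℝ) ^ ((1 - β) * q) := by
    rw [hT2, Real.rpow_def_of_pos hn0, hκ]; congr 1; ring
  have hTp : (T ^ (-(2 * α))) ^ 2 = κ ^ (-(2 * α)) * (Real.log n) ^ (-(2 * α)) := by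
    rw [← Real.mul_rpow hκ0.le hL.le, ← hT2, ← Real.rpow_natCast, ← Real.rpow_natCast,
      ← Real.rpow_mul hTpos.le, ← Real.rpow_mul hTpos.le]
    congr 1; push_cast; ring
  have hR1 : (n : ℝ) ^ (-(2 * α)) * (S * (C * T ^ (-(2 * α)))) ^ 2
      = C ^ 2 * κ ^ (-(2 * α)) * ((S : ℝ) ^ 2 / ((n : ℝ) * Real.log n) ^ (2 * α)) := by
    rw [mul_pow, mul_pow, hTp, Real.mul_rpow hn0.le hL.le, Real.rpow_neg hn0.le,
      Real.rpow_neg hL.le]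
    have := Real.rpow_pos_of_pos hn0 (2 * α)
    have := Real.rpow_pos_of_pos hL (2 * α)
    field_simp
  have hR2 : (n : ℝ) ^ (-(2 * α)) * ((n : ℝ) ^ q * (S : ℝ) ^ (2 - 2 * α))
      = (S : ℝ) ^ (2 - 2 * α) / n := by
    rw [← mul_assoc, ← Real.rpow_add hn0, hq, show -(2 * α) + (2 * α - 1) = -1 by ring,
      Real.rpow_neg_one]; ring
  have hSq : (S : ℝ) ^ q ≤ K ^ q * (n : ℝ) ^ (β * q) := by
    rw [Real.rpow_mul hn0.le, ← Real.mul_rpow hK.le (Real.rpow_nonneg hn0.le _)]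
    exact Real.rpow_le_rpow hS0.le (hSn S n hS hn hyp) hq0.le
  have hSsplit : (S : ℝ) = (S : ℝ) ^ (2 - 2 * α) * (S : ℝ) ^ q := by
    rw [← Real.rpow_add hS0, hq]; ring_nf; simp
  have hR3 : (n : ℝ) ^ (-(2 * α)) * (S * Real.exp (T ^ 2 / 2))
      ≤ K ^ q * ((S : ℝ) ^ (2 - 2 * α) / n) := by
    rw [hexp]
    calc (n : ℝ) ^ (-(2 * α)) * (S * (n : ℝ) ^ ((1 - β) * q))
        = (n : ℝ) ^ (-(2 * α)) * ((S : ℝ) ^ (2 - 2 * α) * (S : ℝ) ^ q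
          * (n : ℝ) ^ ((1 - β) * q)) := by rw [← hSsplit]
      _ ≤ (n : ℝ) ^ (-(2 * α)) * ((S : ℝ) ^ (2 - 2 * α) * (K ^ q * (n : ℝ) ^ (β * q))
          * (n : ℝ) ^ ((1 - β) * q)) := by gcongr
      _ = K ^ q * (S : ℝ) ^ (2 - 2 * α) * ((n : ℝ) ^ (-(2 * α)) * ((n : ℝ) ^ (β * q)
          * (n : ℝ) ^ ((1 - β) * q))) := by ring
      _ = _ := by
          rw [← Real.rpow_add hn0, ← Real.rpow_add hn0,
            show -(2 * α) + (β * q + (1 - β) * q) = -1 by rw [hq]; ring, Real.rpow_neg_one]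
          ring
  have hR4 : (n : ℝ) ^ (-(2 * α)) * S ≤ (n : ℝ) ^ (-(2 * α)) * (S * Real.exp (T ^ 2 / 2)) := by
    refine mul_le_mul_of_nonneg_left ?_ (Real.rpow_nonneg hn0.le _)
    refine le_mul_of_one_le_right hS0.le (Real.one_le_exp (by positivity))
  set R1 := (S : ℝ) ^ 2 / ((n : ℝ) * Real.log n) ^ (2 * α)
  set R2 := (S : ℝ) ^ (2 - 2 * α) / (n : ℝ)
  have hR1n : 0 ≤ R1 := by positivity
  have hR2n : 0 ≤ R2 := by positivity
  have hKq : 0 < K ^ q := by positivity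
  have hκα : 0 < κ ^ (-(2 * α)) := by positivity
  calc _ = C * ((n : ℝ) ^ (-(2 * α)) * S
        + (n : ℝ) ^ (-(2 * α)) * ((n : ℝ) ^ q * (S : ℝ) ^ (2 - 2 * α))
        + (n : ℝ) ^ (-(2 * α)) * (S * Real.exp (T ^ 2 / 2)))
        + (n : ℝ) ^ (-(2 * α)) * (S * (C * T ^ (-(2 * α)))) ^ 2 := by ring
    _ ≤ C * (K ^ q * R2 + R2 + K ^ q * R2) + C ^ 2 * κ ^ (-(2 * α)) * R1 := by
        rw [hR1, hR2]
        have := hR4.trans hR3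
        refine add_le_add (mul_le_mul_of_nonneg_left ?_ hC.le) le_rfl
        linarith
    _ ≤ _ := by
        have : 0 ≤ C * (1 + 2 * K ^ q) * R1 := by positivity
        have : 0 ≤ C ^ 2 * κ ^ (-(2 * α)) * R2 := by positivity
        nlinarith

lemma poissonPMF_nonneg {S : ℕ} {lam : ℝ} {P : Fin S → ℝ} (hP : ∀ i, 0 ≤ lam * P i)
    (z : Fin S → ℕ) : 0 ≤ poissonPMF S lam P z :=
  Finset.prod_nonneg fun i _ => by
    have := hP i
    positivity

lemma sum_poissonPMF_le_one {S : ℕ} {lam : ℝ} {P : Fin S → ℝ} (hP : ∀ i, 0 ≤ lam * P i)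
    (A : Finset (Fin S → ℕ)) : ∑ z ∈ A, poissonPMF S lam P z ≤ 1 := by
  have h := poissonRisk_eq_lintegral hP 0 (fun _ => 1)
  simp only [poissonRisk, sub_zero, one_pow, mul_one, ENNReal.ofReal_one, lintegral_one,
    measure_univ] at h
  have h1 := ENNReal.sum_le_tsum (f := fun z => ENNReal.ofReal (poissonPMF S lam P z)) A
  rw [h, ← ENNReal.ofReal_sum_of_nonneg fun z _ => poissonPMF_nonneg hP z,
    ENNReal.ofReal_le_one] at h1
  exact h1

/-- Two-mixture lower bound for the minimax risk. -/
lemma le_poissonMinimax_of_mixtures {S : ℕ} {lam : ℝ} (hlam : 0 ≤ lam) (F : (Fin S → ℝ) → ℝ)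
    {J : Type*} [Fintype J] {P : J → Fin S → ℝ} (hP : ∀ j, P j ∈ simplex S)
    {w : Bool → J → ℝ} (hw : ∀ b j, 0 ≤ w b j) {t : Bool → ℝ} {V : ℝ}
    (hV : ∀ b, ∑ j, w b j * (F (P j) - t b) ^ 2 ≤ V) (A : Finset (Fin S → ℕ))
    (hw1 : ∀ b, ∑ j, w b j = 1) :
    ENNReal.ofReal ((t true - t false) ^ 2 / 8 *
      ∑ z ∈ A, min (∑ j, w false j * poissonPMF S lam (P j) z)
        (∑ j, w true j * poissonPMF S lam (P j) z) - V)
      ≤ poissonMinimax S lam F := by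
  refine le_iInf fun est => ?_
  set R := ⨆ P ∈ simplex S, poissonRisk S lam P (F P) est with hR
  rcases eq_or_ne R ⊤ with hRt | hRt
  · rw [hRt]; exact le_top
  rw [ENNReal.ofReal_le_iff_le_toReal hRt]
  have hnn : ∀ j i, 0 ≤ lam * P j i := fun j i => mul_nonneg hlam ((hP j).1 i)
  have hpmf : ∀ j z, 0 ≤ poissonPMF S lam (P j) z := fun j z => poissonPMF_nonneg (hnn j) z
  have hrisk : ∀ j, ∑ z ∈ A, poissonPMF S lam (P j) z * (est z - F (P j)) ^ 2 ≤ R.toReal :=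
    fun j => by
    rw [← ENNReal.ofReal_le_iff_le_toReal hRt,
      ENNReal.ofReal_sum_of_nonneg fun z _ => mul_nonneg (hpmf j z) (sq_nonneg _)]
    refine (ENNReal.sum_le_tsum A).trans ?_
    exact le_iSup₂_of_le (P j) (hP j) le_rfl
  have hmix : ∀ b, ∑ z ∈ A, (∑ j, w b j * poissonPMF S lam (P j) z) * (est z - t b) ^ 2
      ≤ 2 * (R.toReal + V) := fun b => by
    have h1 : ∑ j, w b j * ∑ z ∈ A, poissonPMF S lam (P j) z * (est z - F (P j)) ^ 2
        ≤ R.toReal := by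
      calc _ ≤ ∑ j, w b j * R.toReal :=
            Finset.sum_le_sum fun j _ => mul_le_mul_of_nonneg_left (hrisk j) (hw b j)
        _ = R.toReal := by rw [← Finset.sum_mul, hw1, one_mul]
    have h2 : ∑ j, w b j * ∑ z ∈ A, poissonPMF S lam (P j) z * (F (P j) - t b) ^ 2 ≤ V := by
      refine le_trans (Finset.sum_le_sum fun j _ => mul_le_mul_of_nonneg_left ?_ (hw b j)) (hV b)
      rw [← Finset.sum_mul]
      exact mul_le_of_le_one_left (sq_nonneg _) (sum_poissonPMF_le_one (hnn j) A)
    have h3 : ∑ z ∈ A, (∑ j, w b j * poissonPMF S lam (P j) z) * (est z - t b) ^ 2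
        = ∑ j, w b j * ∑ z ∈ A, poissonPMF S lam (P j) z * (est z - t b) ^ 2 := by
      simp_rw [Finset.sum_mul, Finset.mul_sum]
      rw [Finset.sum_comm]
      simp_rw [mul_assoc]
    calc _ = _ := h3
      _ ≤ ∑ j, w b j * ∑ z ∈ A, poissonPMF S lam (P j) z *
            (2 * ((est z - F (P j)) ^ 2 + (F (P j) - t b) ^ 2)) := by
          refine Finset.sum_le_sum fun j _ => mul_le_mul_of_nonneg_left
            (Finset.sum_le_sum fun z _ => mul_le_mul_of_nonneg_left ?_ (hpmf j z)) (hw b j)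
          nlinarith [sq_nonneg ((est z - F (P j)) - (F (P j) - t b))]
      _ = 2 * (∑ j, w b j * ∑ z ∈ A, poissonPMF S lam (P j) z * (est z - F (P j)) ^ 2
            + ∑ j, w b j * ∑ z ∈ A, poissonPMF S lam (P j) z * (F (P j) - t b) ^ 2) := by
          rw [← Finset.sum_add_distrib, Finset.mul_sum]
          refine Finset.sum_congr rfl fun j _ => ?_
          rw [← mul_add, ← Finset.sum_add_distrib, mul_left_comm]
          congr 1
          rw [Finset.mul_sum]
          exact Finset.sum_congr rfl fun z _ => by ring
      _ ≤ _ := by linarith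
  set p : Bool → (Fin S → ℕ) → ℝ := fun b z => ∑ j, w b j * poissonPMF S lam (P j) z
  have hmin : (t true - t false) ^ 2 / 2 * ∑ z ∈ A, min (p false z) (p true z)
      ≤ 4 * (R.toReal + V) := by
    calc _ = ∑ z ∈ A, min (p false z) (p true z) * ((t true - t false) ^ 2 / 2) := by
          rw [Finset.mul_sum]; exact Finset.sum_congr rfl fun z _ => mul_comm _ _
      _ ≤ ∑ z ∈ A, (p false z * (est z - t false) ^ 2 + p true z * (est z - t true) ^ 2) := by
          refine Finset.sum_le_sum fun z _ => ?_
          have h0 : 0 ≤ min (p false z) (p true z) :=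
            le_min (Finset.sum_nonneg fun j _ => mul_nonneg (hw _ j) (hpmf j z))
              (Finset.sum_nonneg fun j _ => mul_nonneg (hw _ j) (hpmf j z))
          calc _ ≤ min (p false z) (p true z)
                * ((est z - t false) ^ 2 + (est z - t true) ^ 2) := by
                refine mul_le_mul_of_nonneg_left ?_ h0
                nlinarith [sq_nonneg ((est z - t false) + (est z - t true))]
            _ ≤ _ := by
                rw [mul_add]
                exact add_le_add
                  (mul_le_mul_of_nonneg_right (min_le_left _ _) (sq_nonneg _))
                  (mul_le_mul_of_nonneg_right (min_le_right _ _) (sq_nonneg _))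
      _ ≤ _ := by
          rw [Finset.sum_add_distrib]
          linarith [hmix false, hmix true]
  linarith

/-- Boxes of observations. -/
lemma sum_piFinset_poisson_prod {S : ℕ} (u : Fin S → ℕ → ℝ) (B : ℕ) :
    ∑ z ∈ Fintype.piFinset (fun _ : Fin S => Finset.range B), ∏ i, u i (z i)
      = ∏ i, ∑ k ∈ Finset.range B, u i k := by
  rw [Finset.prod_univ_sum]

lemma tendsto_affinity {x y : ℝ} (hx : 0 ≤ x) (hy : 0 ≤ y) :
    Filter.Tendsto (fun B : ℕ => ∑ k ∈ Finset.range B,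
      √((Real.exp (-x) * x ^ k / (k.factorial : ℝ)) * (Real.exp (-y) * y ^ k / (k.factorial : ℝ))))
      Filter.atTop (nhds (Real.exp (-((√x - √y) ^ 2 / 2)))) := by
  have hterm : ∀ k : ℕ, √((Real.exp (-x) * x ^ k / (k.factorial : ℝ)) *
      (Real.exp (-y) * y ^ k / (k.factorial : ℝ)))
      = Real.exp (-(x + y) / 2) * ((√x * √y) ^ k / (k.factorial : ℝ)) := fun k => by
    rw [Real.sqrt_eq_iff_mul_self_eq (by positivity) (by positivity), eq_comm]
    have h1 : Real.exp (-(x + y) / 2) * Real.exp (-(x + y) / 2) = Real.exp (-x) * Real.exp (-y) := by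
      rw [← Real.exp_add, ← Real.exp_add]; ring_nf
    have h2 : (√x * √y) ^ k * (√x * √y) ^ k = x ^ k * y ^ k := by
      rw [← mul_pow, ← mul_pow]; congr 1
      rw [mul_mul_mul_comm, Real.mul_self_sqrt hx, Real.mul_self_sqrt hy]
    calc _ = (Real.exp (-(x + y) / 2) * Real.exp (-(x + y) / 2))
        * ((√x * √y) ^ k * (√x * √y) ^ k) / ((k.factorial : ℝ) * k.factorial) := by ring
      _ = _ := by rw [h1, h2]; ring
  simp_rw [hterm]
  have h := (NormedSpace.expSeries_div_hasSum_exp (𝔸 := ℝ) (√x * √y)).mul_left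
    (Real.exp (-(x + y) / 2))
  rw [← Real.exp_eq_exp_ℝ, ← Real.exp_add] at h
  have he : -(x + y) / 2 + √x * √y = -((√x - √y) ^ 2 / 2) := by
    have := Real.sq_sqrt hx
    have := Real.sq_sqrt hy
    nlinarith
  rw [he] at h
  exact h.tendsto_sum_nat

/-- Two-point lower bound: if the Hellinger affinity is not small then the risk is of the order of
the squared separation. -/
lemma le_poissonMinimax_of_two_points {S : ℕ} {lam : ℝ} (hlam : 0 ≤ lam) (F : (Fin S → ℝ) → ℝ)
    {P Q : Fin S → ℝ} (hP : P ∈ simplex S) (hQ : Q ∈ simplex S)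
    (hPQ : ∑ i, (√(lam * P i) - √(lam * Q i)) ^ 2 ≤ 1) :
    ENNReal.ofReal ((F Q - F P) ^ 2 / 256) ≤ poissonMinimax S lam F := by
  have hP' : ∀ i, 0 ≤ lam * P i := fun i => mul_nonneg hlam (hP.1 i)
  have hQ' : ∀ i, 0 ≤ lam * Q i := fun i => mul_nonneg hlam (hQ.1 i)
  have hlim := tendsto_finsetProd (Finset.univ : Finset (Fin S)) fun i _ =>
    tendsto_affinity (hP' i) (hQ' i)
  rw [← Real.exp_sum, Finset.sum_neg_distrib, ← Finset.sum_div] at hlim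
  have hhalf : (1 / 4 : ℝ) < Real.exp (-((∑ i, (√(lam * P i) - √(lam * Q i)) ^ 2) / 2)) := by
    have := Real.add_one_le_exp (-((∑ i, (√(lam * P i) - √(lam * Q i)) ^ 2) / 2))
    linarith
  obtain ⟨B, hB⟩ := (hlim.eventually_const_lt hhalf).exists
  rw [← sum_piFinset_poisson_prod (fun i k =>
    √((Real.exp (-(lam * P i)) * (lam * P i) ^ k / (k.factorial : ℝ)) *
      (Real.exp (-(lam * Q i)) * (lam * Q i) ^ k / (k.factorial : ℝ)))) B] at hB
  set A := Fintype.piFinset (fun _ : Fin S => Finset.range B)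
  have hsqrt : ∀ z : Fin S → ℕ, ∏ i, √((Real.exp (-(lam * P i)) * (lam * P i) ^ (z i) /
      ((z i).factorial : ℝ)) * (Real.exp (-(lam * Q i)) * (lam * Q i) ^ (z i) /
      ((z i).factorial : ℝ))) = √(poissonPMF S lam P z) * √(poissonPMF S lam Q z) := fun z => by
    rw [← Real.sqrt_mul (poissonPMF_nonneg hP' z), poissonPMF, poissonPMF,
      ← Finset.prod_mul_distrib, Real.sqrt_prod]
    intro i _
    have := hP' i
    have := hQ' i
    positivity
  simp only [hsqrt] at hB
  have hpn := fun z => poissonPMF_nonneg hP' z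
  have hqn := fun z => poissonPMF_nonneg hQ' z
  have hmm : ∀ z, √(poissonPMF S lam P z) * √(poissonPMF S lam Q z)
      = √(min (poissonPMF S lam P z) (poissonPMF S lam Q z))
        * √(max (poissonPMF S lam P z) (poissonPMF S lam Q z)) := fun z => by
    rw [← Real.sqrt_mul (hpn z), ← Real.sqrt_mul (le_min (hpn z) (hqn z)), min_mul_max]
  have hcs := Real.sum_sqrt_mul_sqrt_le A
    (f := fun z => min (poissonPMF S lam P z) (poissonPMF S lam Q z))
    (g := fun z => max (poissonPMF S lam P z) (poissonPMF S lam Q z))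
    (fun z => le_min (hpn z) (hqn z)) (fun z => (hpn z).trans (le_max_left _ _))
  simp only [← hmm] at hcs
  have hmax : ∑ z ∈ A, max (poissonPMF S lam P z) (poissonPMF S lam Q z) ≤ 2 := by
    calc _ ≤ ∑ z ∈ A, (poissonPMF S lam P z + poissonPMF S lam Q z) :=
          Finset.sum_le_sum fun z _ => max_le_add_of_nonneg (hpn z) (hqn z)
      _ ≤ _ := by
          rw [Finset.sum_add_distrib]
          linarith [sum_poissonPMF_le_one hP' A, sum_poissonPMF_le_one hQ' A]
  set m := ∑ z ∈ A, min (poissonPMF S lam P z) (poissonPMF S lam Q z) with hm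
  have hm0 : 0 ≤ m := Finset.sum_nonneg fun z _ => le_min (hpn z) (hqn z)
  have hmge : 1 / 32 ≤ m := by
    rw [← Real.sqrt_mul hm0] at hcs
    have h1 : (1 / 4 : ℝ) ≤ √(m * 2) :=
      (hB.le.trans hcs).trans (Real.sqrt_le_sqrt (mul_le_mul_of_nonneg_left hmax hm0))
    rw [Real.le_sqrt (by norm_num) (by positivity)] at h1
    linarith
  have key := le_poissonMinimax_of_mixtures hlam F (J := Bool) (P := fun b => if b then Q else P)
    (by intro j; cases j <;> simp [hP, hQ]) (w := fun b j => if b = j then 1 else 0)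
    (by intro b j; split_ifs <;> norm_num) (t := fun b => if b then F Q else F P) (V := 0)
    (by intro b; cases b <;> simp) A (by intro b; simp)
  refine le_trans (ENNReal.ofReal_le_ofReal ?_) key
  simp only [Fintype.sum_bool]
  simp only [if_true, if_false, Bool.false_eq_true, Bool.true_eq_false, one_mul, zero_mul,
    zero_add, add_zero, ← hm]
  nlinarith [sq_nonneg (F Q - F P)]

lemma rpow_le_tangent {α x y : ℝ} (h0 : 0 ≤ α) (h1 : α ≤ 1) (hx : 0 ≤ x) (hy : 0 < y) :
    x ^ α ≤ y ^ α + α * y ^ (α - 1) * (x - y) := by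
  have h := rpow_one_add_le_one_add_mul_self (s := x / y - 1)
    (by have := div_nonneg hx hy.le; linarith) h0 h1
  rw [add_sub_cancel, Real.div_rpow hx hy.le, div_le_iff₀ (Real.rpow_pos_of_pos hy _)] at h
  refine h.trans_eq ?_
  have h2 : y ^ α = y ^ (α - 1) * y := by
    rw [Real.rpow_sub_one hy.ne']; field_simp
  rw [h2]; field_simp

/-- The distribution putting mass `1 - a` on one symbol and spreading `a` over the others. -/
noncomputable def spikeDist (k : ℕ) (a : ℝ) : Fin (k + 1) → ℝ :=
  Fin.cons (1 - a) fun _ => a / k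

lemma spikeDist_mem_simplex {k : ℕ} (hk : 0 < k) {a : ℝ} (h0 : 0 ≤ a) (h1 : a ≤ 1) :
    spikeDist k a ∈ simplex (k + 1) := by
  have hk' : (0 : ℝ) < k := by exact_mod_cast hk
  constructor
  · intro i
    refine Fin.cases ?_ (fun j => ?_) i
    · simp [spikeDist, h1]
    · simp only [spikeDist, Fin.cons_succ]; positivity
  · rw [Fin.sum_univ_succ]
    simp only [spikeDist, Fin.cons_zero, Fin.cons_succ, Finset.sum_const, Finset.card_univ,
      Fintype.card_fin, nsmul_eq_mul]
    field_simp; ring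

lemma Falpha_spikeDist {k : ℕ} (hk : 0 < k) {α a : ℝ} (h0 : 0 ≤ a) :
    Falpha (k + 1) α (spikeDist k a) = (1 - a) ^ α + (k : ℝ) ^ (1 - α) * a ^ α := by
  have hk' : (0 : ℝ) < k := by exact_mod_cast hk
  rw [Falpha, Fin.sum_univ_succ]
  simp only [spikeDist, Fin.cons_zero, Fin.cons_succ, Finset.sum_const, Finset.card_univ,
    Fintype.card_fin, nsmul_eq_mul]
  rw [Real.div_rpow h0 hk'.le, Real.rpow_sub hk', Real.rpow_one]
  ring

lemma sq_sqrt_sub_sqrt_le {x y : ℝ} (hx : 0 < x) (hy : 0 ≤ y) :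
    (√x - √y) ^ 2 ≤ (x - y) ^ 2 / x := by
  rw [le_div_iff₀ hx]
  have h1 := Real.sq_sqrt hx.le
  have h2 := Real.sq_sqrt hy
  have h3 := Real.sqrt_nonneg x
  have h4 := Real.sqrt_nonneg y
  have : (x - y) ^ 2 = (√x - √y) ^ 2 * (√x + √y) ^ 2 := by
    rw [← mul_pow]; congr 1; nlinarith
  rw [this]
  refine mul_le_mul_of_nonneg_left ?_ (sq_nonneg _)
  nlinarith

/-- The parametric part of the lower bound. -/
theorem parametric_le_poissonMinimax {α : ℝ} (hα0 : 0 < α) (hα : α < 1) :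
    ∃ c : ℝ, 0 < c ∧ ∀ S n : ℕ, 2 ≤ S → 1 ≤ n →
      ENNReal.ofReal (c * ((S : ℝ) ^ (2 - 2 * α) / (n : ℝ)))
        ≤ poissonMinimax S (n : ℝ) (Falpha S α) := by
  set D := (3 / 8 : ℝ) ^ (α - 1) - (5 / 8 : ℝ) ^ (α - 1) with hD
  have hD0 : 0 < D := sub_pos.2
    (Real.rpow_lt_rpow_of_neg (by norm_num) (by norm_num) (by linarith))
  refine ⟨(α * D / 8) ^ 2 * (1 / 2 : ℝ) ^ (2 - 2 * α) / 256, by positivity, fun S n hS hn => ?_⟩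
  obtain ⟨k, rfl⟩ : ∃ k, S = k + 1 := ⟨S - 1, by omega⟩
  have hk : 0 < k := by omega
  have hk1 : (1 : ℝ) ≤ k := by exact_mod_cast hk
  have hn1 : (1 : ℝ) ≤ n := by exact_mod_cast hn
  have hn0 : (0 : ℝ) < n := by linarith
  set δ := 1 / (8 * √(n : ℝ)) with hδ
  have hsq1 : 1 ≤ √(n : ℝ) := Real.one_le_sqrt.2 hn1
  have hδ0 : 0 < δ := by positivity
  have hδ2 : δ ^ 2 = 1 / (64 * n) := by
    rw [hδ, div_pow, mul_pow, Real.sq_sqrt hn0.le]; norm_num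
  have hδ1 : δ ≤ 1 / 8 := by
    rw [hδ]; apply one_div_le_one_div_of_le <;> linarith
  have hP := spikeDist_mem_simplex hk (a := 1 / 4) (by norm_num) (by norm_num)
  have hQ := spikeDist_mem_simplex hk (a := 1 / 4 + δ) (by linarith) (by linarith)
  have hPQ : ∑ i, (√(n * spikeDist k (1 / 4) i) - √(n * spikeDist k (1 / 4 + δ) i)) ^ 2 ≤ 1 := by
    have hle : ∀ i, (√(n * spikeDist k (1 / 4) i) - √(n * spikeDist k (1 / 4 + δ) i)) ^ 2
        ≤ n * (spikeDist k (1 / 4) i - spikeDist k (1 / 4 + δ) i) ^ 2 / spikeDist k (1 / 4) i :=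
      fun i => by
      have hpos : 0 < spikeDist k (1 / 4) i := by
        refine Fin.cases ?_ (fun j => ?_) i
        · simp only [spikeDist, Fin.cons_zero]; norm_num
        · simp only [spikeDist, Fin.cons_succ]; positivity
      refine (sq_sqrt_sub_sqrt_le (by positivity) (mul_nonneg hn0.le (hQ.1 i))).trans_eq ?_
      field_simp
    refine (Finset.sum_le_sum fun i _ => hle i).trans ?_
    rw [Fin.sum_univ_succ]
    simp only [spikeDist, Fin.cons_zero, Fin.cons_succ, Finset.sum_const, Finset.card_univ,
      Fintype.card_fin, nsmul_eq_mul]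
    have e1 : (1 - 1 / 4 - (1 - (1 / 4 + δ))) ^ 2 = 1 / (64 * (n : ℝ)) := by rw [← hδ2]; ring
    have e2 : ((1 / 4 : ℝ) / k - (1 / 4 + δ) / k) ^ 2 = 1 / (64 * n) / k ^ 2 := by
      rw [← hδ2]; ring
    rw [e1, e2]
    have : (k : ℝ) * (n * (1 / (64 * n) / k ^ 2) / (1 / 4 / k)) = 1 / 16 := by
      field_simp; norm_num
    rw [this]
    have : (n : ℝ) * (1 / (64 * n)) / (1 - 1 / 4) = 1 / 48 := by
      field_simp; norm_num
    rw [this]; norm_num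
  refine le_trans (ENNReal.ofReal_le_ofReal ?_)
    (le_poissonMinimax_of_two_points hn0.le (Falpha (k + 1) α) hP hQ hPQ)
  rw [Falpha_spikeDist hk (a := 1 / 4) (by norm_num), Falpha_spikeDist hk (by linarith)]
  have hkα : 1 ≤ (k : ℝ) ^ (1 - α) := Real.one_le_rpow hk1 (by linarith)
  have t1 := rpow_le_tangent (α := α) hα0.le hα.le (x := 1 / 4) (y := 1 / 4 + δ) (by norm_num)
    (by linarith)
  have t2 := rpow_le_tangent (α := α) hα0.le hα.le (x := 1 - 1 / 4) (y := 1 - (1 / 4 + δ))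
    (by norm_num) (by linarith)
  have m1 : (3 / 8 : ℝ) ^ (α - 1) ≤ (1 / 4 + δ) ^ (α - 1) :=
    Real.rpow_le_rpow_of_nonpos (by linarith) (by linarith) (by linarith)
  have m2 : (1 - (1 / 4 + δ)) ^ (α - 1) ≤ (5 / 8 : ℝ) ^ (α - 1) :=
    Real.rpow_le_rpow_of_nonpos (by linarith) (by linarith) (by linarith)
  have u1 : α * (3 / 8 : ℝ) ^ (α - 1) * δ ≤ (1 / 4 + δ) ^ α - (1 / 4) ^ α := by
    have := mul_le_mul_of_nonneg_left m1 (mul_pos hα0 hδ0).le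
    nlinarith
  have u2 : (1 - 1 / 4) ^ α - (1 - (1 / 4 + δ)) ^ α ≤ α * (5 / 8 : ℝ) ^ (α - 1) * δ := by
    have := mul_le_mul_of_nonneg_left m2 (mul_pos hα0 hδ0).le
    nlinarith
  set K := (k : ℝ) ^ (1 - α) with hK
  have hgap : α * D * δ * K ≤ ((1 - (1 / 4 + δ)) ^ α + K * (1 / 4 + δ) ^ α)
      - ((1 - 1 / 4) ^ α + K * (1 / 4) ^ α) := by
    have h5 : 0 ≤ α * (5 / 8 : ℝ) ^ (α - 1) * δ := by positivity
    have := mul_le_mul_of_nonneg_left u1 (zero_le_one.trans hkα)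
    have := mul_le_mul_of_nonneg_right hkα h5
    have e : α * D * δ * K = K * (α * (3 / 8 : ℝ) ^ (α - 1) * δ)
        - K * (α * (5 / 8 : ℝ) ^ (α - 1) * δ) := by rw [hD]; ring
    rw [e]
    linarith
  have hSk : (1 / 2 : ℝ) ^ (2 - 2 * α) * ((k + 1 : ℕ) : ℝ) ^ (2 - 2 * α) ≤ K ^ 2 := by
    rw [← Real.mul_rpow (by norm_num) (by positivity), hK, ← Real.rpow_natCast,
      ← Real.rpow_mul (by positivity), show (1 - α) * ((2 : ℕ) : ℝ) = 2 - 2 * α by push_cast; ring]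
    refine Real.rpow_le_rpow (by positivity) ?_ (by linarith)
    push_cast; linarith
  have hsqgap := pow_le_pow_left₀ (by positivity) hgap 2
  calc _ = α ^ 2 * D ^ 2 * δ ^ 2 * ((1 / 2 : ℝ) ^ (2 - 2 * α)
        * ((k + 1 : ℕ) : ℝ) ^ (2 - 2 * α)) / 256 := by
        rw [hδ2]; field_simp; norm_num
    _ ≤ α ^ 2 * D ^ 2 * δ ^ 2 * K ^ 2 / 256 := by gcongr
    _ = (α * D * δ * K) ^ 2 / 256 := by ring
    _ ≤ _ := by gcongr

/-- The `j`-th node on the circle divided into `4 * m` equal arcs. -/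
noncomputable def circleAngle (m j : ℕ) : ℝ := 2 * Real.pi * j / (4 * m)

lemma sum_cos_circleAngle {m : ℕ} (hm : 0 < m) (d : ℤ) :
    ∑ j ∈ Finset.range (4 * m), Real.cos (d * circleAngle m j)
      = if (4 * m : ℤ) ∣ d then 4 * (m : ℝ) else 0 := by
  have hm' : (m : ℂ) ≠ 0 := by exact_mod_cast hm.ne'
  set ζ : ℂ := Complex.exp (2 * Real.pi * Complex.I * (d / (4 * m))) with hζ
  have hcos : ∀ j : ℕ, Real.cos (d * circleAngle m j) = (ζ ^ j).re := fun j => by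
    rw [hζ, ← Complex.exp_nat_mul,
      show (j : ℂ) * (2 * Real.pi * Complex.I * (d / (4 * m)))
        = ((d * circleAngle m j : ℝ) : ℂ) * Complex.I by
        rw [circleAngle]; push_cast; field_simp, Complex.exp_ofReal_mul_I_re]
  simp_rw [hcos]
  rw [← Complex.re_sum]
  split_ifs with h
  · obtain ⟨e, rfl⟩ := h
    have h1 : ζ = 1 := by
      rw [hζ, Complex.exp_eq_one_iff]
      refine ⟨e, ?_⟩
      push_cast; field_simp
    simp [h1]
  · have h1 : ζ ≠ 1 := fun h1 => h <| by
      rw [hζ, Complex.exp_eq_one_iff] at h1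
      obtain ⟨e, he⟩ := h1
      refine ⟨e, ?_⟩
      have hpi : (2 * Real.pi * Complex.I : ℂ) ≠ 0 := Complex.two_pi_I_ne_zero
      have h2 : (d : ℂ) / (4 * m) = e := by
        apply mul_left_cancel₀ hpi; rw [he]; ring
      rw [div_eq_iff (by simpa using hm')] at h2
      have h3 : (d : ℂ) = ((4 * m * e : ℤ) : ℂ) := by rw [h2]; push_cast; ring
      exact_mod_cast h3
    have h2 : ζ ^ (4 * m) = 1 := by
      rw [hζ, ← Complex.exp_nat_mul, Complex.exp_eq_one_iff]
      refine ⟨d, ?_⟩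
      push_cast; field_simp
    rw [geom_sum_eq h1, h2]; simp

/-- The Fejér kernel `‖∑ r < m, exp (i r θ)‖ ^ 2`. -/
noncomputable def fejer (m : ℕ) (θ : ℝ) : ℝ :=
  ∑ r ∈ Finset.range m, ∑ s ∈ Finset.range m, Real.cos (((r : ℤ) - s : ℤ) * θ)

lemma fejer_eq_normSq (m : ℕ) (θ : ℝ) :
    fejer m θ = Complex.normSq (∑ r ∈ Finset.range m, Complex.exp (θ * Complex.I) ^ r) := by
  have h : ∀ r : ℕ, Complex.exp (θ * Complex.I) ^ r = Complex.exp (((r * θ : ℝ) : ℂ) * Complex.I) :=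
    fun r => by rw [← Complex.exp_nat_mul]; push_cast; ring_nf
  simp_rw [h]
  rw [Complex.normSq_apply, Complex.re_sum, Complex.im_sum]
  simp_rw [Complex.exp_ofReal_mul_I_re, Complex.exp_ofReal_mul_I_im]
  rw [Finset.sum_mul_sum, Finset.sum_mul_sum, fejer, ← Finset.sum_add_distrib]
  refine Finset.sum_congr rfl fun r _ => ?_
  rw [← Finset.sum_add_distrib]
  refine Finset.sum_congr rfl fun s _ => ?_
  rw [← Real.cos_sub]; push_cast; ring_nf

lemma fejer_nonneg (m : ℕ) (θ : ℝ) : 0 ≤ fejer m θ := by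
  rw [fejer_eq_normSq]; exact Complex.normSq_nonneg _

lemma fejer_le (m : ℕ) (θ : ℝ) : fejer m θ ≤ (m : ℝ) ^ 2 := by
  calc fejer m θ ≤ ∑ r ∈ Finset.range m, ∑ s ∈ Finset.range m, (1 : ℝ) :=
        Finset.sum_le_sum fun r _ => Finset.sum_le_sum fun s _ => Real.cos_le_one _
    _ = _ := by simp [sq]

lemma fejer_mul_one_sub_cos (m : ℕ) (θ : ℝ) :
    fejer m θ * (1 - Real.cos θ) = 1 - Real.cos (m * θ) := by
  have hn : ∀ x : ℝ, Complex.normSq (Complex.exp (x * Complex.I) - 1) = 2 * (1 - Real.cos x) :=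
    fun x => by
    rw [Complex.normSq_apply]
    simp only [Complex.sub_re, Complex.sub_im, Complex.exp_ofReal_mul_I_re,
      Complex.exp_ofReal_mul_I_im, Complex.one_re, Complex.one_im]
    nlinarith [Real.sin_sq_add_cos_sq x]
  have h := congrArg Complex.normSq (geom_sum_mul (Complex.exp (θ * Complex.I)) m)
  rw [map_mul, ← fejer_eq_normSq, hn, ← Complex.exp_nat_mul,
    show (m : ℂ) * (θ * Complex.I) = ((m * θ : ℝ) : ℂ) * Complex.I by push_cast; ring, hn] at h
  linarith

/-- The signed weight of the `j`-th node. -/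
noncomputable def signedFejer (m j : ℕ) : ℝ := (-1) ^ j * fejer m (circleAngle m j)

lemma abs_signedFejer (m j : ℕ) : |signedFejer m j| = fejer m (circleAngle m j) := by
  rw [signedFejer, abs_mul, abs_pow, abs_neg, abs_one, one_pow, one_mul,
    abs_of_nonneg (fejer_nonneg _ _)]

lemma neg_one_pow_eq_cos {m : ℕ} (hm : 0 < m) (j : ℕ) :
    (-1 : ℝ) ^ j = Real.cos ((2 * m : ℤ) * circleAngle m j) := by
  have hm' : (m : ℝ) ≠ 0 := by exact_mod_cast hm.ne'
  rw [← Real.cos_nat_mul_pi, circleAngle]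
  congr 1; push_cast; field_simp; norm_num

lemma sum_fejer {m : ℕ} (hm : 0 < m) :
    ∑ j ∈ Finset.range (4 * m), fejer m (circleAngle m j) = 4 * (m : ℝ) ^ 2 := by
  simp only [fejer]
  rw [Finset.sum_comm]
  have h : ∀ r ∈ Finset.range m, ∑ j ∈ Finset.range (4 * m), ∑ s ∈ Finset.range m,
      Real.cos (((r : ℤ) - s : ℤ) * circleAngle m j) = 4 * m := fun r hr => by
    rw [Finset.sum_comm]
    simp_rw [sum_cos_circleAngle hm]
    rw [Finset.sum_eq_single_of_mem r hr]
    · simp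
    · intro s hs hsr
      rw [if_neg]
      intro hd
      have h1 := Finset.mem_range.1 hr
      have h2 := Finset.mem_range.1 hs
      have := Int.eq_zero_of_abs_lt_dvd hd (by rw [abs_lt]; constructor <;> omega)
      omega
  rw [Finset.sum_congr rfl h]
  simp; ring

lemma cos_mul_cos_eq (x y : ℝ) :
    Real.cos x * Real.cos y = (Real.cos (x + y) + Real.cos (x - y)) / 2 := by
  rw [Real.cos_add, Real.cos_sub]; ring

lemma sum_signedFejer_mul_cos {m : ℕ} (hm : 0 < m) (b : ℤ) :
    0 ≤ ∑ j ∈ Finset.range (4 * m), signedFejer m j * Real.cos (b * circleAngle m j) ∧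
    (|b| ≤ m → ∑ j ∈ Finset.range (4 * m), signedFejer m j * Real.cos (b * circleAngle m j) = 0)
    := by
  have hexp : ∑ j ∈ Finset.range (4 * m), signedFejer m j * Real.cos (b * circleAngle m j)
      = ∑ r ∈ Finset.range m, ∑ s ∈ Finset.range m, 4⁻¹ *
        ((∑ j ∈ Finset.range (4 * m), Real.cos ((2 * m + (r - s) + b : ℤ) * circleAngle m j))
        + (∑ j ∈ Finset.range (4 * m), Real.cos ((2 * m + (r - s) - b : ℤ) * circleAngle m j))
        + (∑ j ∈ Finset.range (4 * m), Real.cos ((2 * m - (r - s) + b : ℤ) * circleAngle m j))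
        + (∑ j ∈ Finset.range (4 * m), Real.cos ((2 * m - (r - s) - b : ℤ) * circleAngle m j)))
      := by
    simp_rw [← Finset.sum_add_distrib, Finset.mul_sum]
    simp_rw [Finset.sum_comm (s := Finset.range m) (t := Finset.range (4 * m))]
    refine Finset.sum_congr rfl fun j _ => ?_
    rw [signedFejer, fejer, neg_one_pow_eq_cos hm, Finset.mul_sum, Finset.sum_mul]
    refine Finset.sum_congr rfl fun r _ => ?_
    rw [Finset.mul_sum, Finset.sum_mul]
    refine Finset.sum_congr rfl fun s _ => ?_
    rw [cos_mul_cos_eq, div_mul_eq_mul_div, add_mul, cos_mul_cos_eq, cos_mul_cos_eq]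
    push_cast
    ring_nf
  rw [hexp]
  simp_rw [sum_cos_circleAngle hm]
  constructor
  · refine Finset.sum_nonneg fun r _ => Finset.sum_nonneg fun s _ => ?_
    have h : ∀ p : Prop, ∀ [Decidable p], (0 : ℝ) ≤ if p then 4 * (m : ℝ) else 0 := fun p _ => by
      split_ifs <;> positivity
    have := h ((4 * m : ℤ) ∣ 2 * m + (r - s) + b)
    positivity
  · intro hb
    rw [abs_le] at hb
    refine Finset.sum_eq_zero fun r hr => Finset.sum_eq_zero fun s hs => ?_
    have h1 := Finset.mem_range.1 hr
    have h2 := Finset.mem_range.1 hs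
    have h : ∀ d : ℤ, 0 < d → d < 4 * m → ¬ (4 * m : ℤ) ∣ d := fun d h0 h1 hd =>
      absurd (Int.le_of_dvd h0 hd) (by omega)
    rw [if_neg (h _ (by omega) (by omega)), if_neg (h _ (by omega) (by omega)),
      if_neg (h _ (by omega) (by omega)), if_neg (h _ (by omega) (by omega))]
    ring

lemma sum_signedFejer_mul_cos_pow_mul_cos {m : ℕ} (hm : 0 < m) (k : ℕ) : ∀ b : ℤ,
    0 ≤ ∑ j ∈ Finset.range (4 * m), signedFejer m j *
      (Real.cos (circleAngle m j) ^ k * Real.cos (b * circleAngle m j)) ∧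
    (|b| + k ≤ m → ∑ j ∈ Finset.range (4 * m), signedFejer m j *
      (Real.cos (circleAngle m j) ^ k * Real.cos (b * circleAngle m j)) = 0) := by
  induction k with
  | zero => intro b; simpa using sum_signedFejer_mul_cos hm b
  | succ k ih =>
    intro b
    have h : ∑ j ∈ Finset.range (4 * m), signedFejer m j *
        (Real.cos (circleAngle m j) ^ (k + 1) * Real.cos (b * circleAngle m j))
        = 2⁻¹ * (∑ j ∈ Finset.range (4 * m), signedFejer m j *
          (Real.cos (circleAngle m j) ^ k * Real.cos ((b + 1 : ℤ) * circleAngle m j))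
          + ∑ j ∈ Finset.range (4 * m), signedFejer m j *
          (Real.cos (circleAngle m j) ^ k * Real.cos ((b - 1 : ℤ) * circleAngle m j))) := by
      rw [← Finset.sum_add_distrib, Finset.mul_sum]
      refine Finset.sum_congr rfl fun j _ => ?_
      have h1 := cos_mul_cos_eq (b * circleAngle m j) (circleAngle m j)
      have h2 : ((b + 1 : ℤ) : ℝ) * circleAngle m j = b * circleAngle m j + circleAngle m j := by
        push_cast; ring
      have h3 : ((b - 1 : ℤ) : ℝ) * circleAngle m j = b * circleAngle m j - circleAngle m j := by
        push_cast; ring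
      rw [h2, h3, pow_succ]
      linear_combination (signedFejer m j * Real.cos (circleAngle m j) ^ k) * h1
    rw [h]
    refine ⟨mul_nonneg (by norm_num) (add_nonneg (ih _).1 (ih _).1), fun hb => ?_⟩
    have a1 := abs_add_le b 1
    have a2 := abs_sub b 1
    rw [abs_one] at a1 a2
    push_cast at hb
    rw [(ih _).2 (by omega), (ih _).2 (by omega)]
    ring

lemma sum_signedFejer_mul_cos_pow {m : ℕ} (hm : 0 < m) (k : ℕ) :
    0 ≤ ∑ j ∈ Finset.range (4 * m), signedFejer m j * Real.cos (circleAngle m j) ^ k ∧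
    (k ≤ m → ∑ j ∈ Finset.range (4 * m), signedFejer m j * Real.cos (circleAngle m j) ^ k = 0) := by
  have h := sum_signedFejer_mul_cos_pow_mul_cos hm k 0
  simp only [Int.cast_zero, zero_mul, Real.cos_zero, mul_one, abs_zero, zero_add,
    Nat.cast_le] at h
  exact h

/-- The node in `[0, 1]` corresponding to the `j`-th angle. -/
noncomputable def chebNode (m j : ℕ) : ℝ := (1 - Real.cos (circleAngle m j)) / 2

lemma chebNode_mem (m j : ℕ) : 0 ≤ chebNode m j ∧ chebNode m j ≤ 1 := by
  have h1 := Real.cos_le_one (circleAngle m j)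
  have h2 := Real.neg_one_le_cos (circleAngle m j)
  constructor <;> rw [chebNode] <;> linarith

lemma sum_signedFejer_mul_pow_mul_pow {m : ℕ} (hm : 0 < m) (a b : ℕ) (hab : a + b ≤ m) :
    ∑ j ∈ Finset.range (4 * m), signedFejer m j * (chebNode m j ^ a * (1 - chebNode m j) ^ b)
      = 0 := by
  have key : ∀ a b k : ℕ, a + b + k ≤ m → ∑ j ∈ Finset.range (4 * m), signedFejer m j *
      (chebNode m j ^ a * (1 - chebNode m j) ^ b * Real.cos (circleAngle m j) ^ k) = 0 := by
    intro a
    induction a with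
    | zero =>
      intro b
      induction b with
      | zero => intro k hk; simpa using (sum_signedFejer_mul_cos_pow hm k).2 (by omega)
      | succ b ih =>
        intro k hk
        have h1 := ih k (by omega)
        have h2 := ih (k + 1) (by omega)
        have : ∀ j, signedFejer m j * (chebNode m j ^ 0 * (1 - chebNode m j) ^ (b + 1) *
            Real.cos (circleAngle m j) ^ k) = 2⁻¹ * (signedFejer m j *
            (chebNode m j ^ 0 * (1 - chebNode m j) ^ b * Real.cos (circleAngle m j) ^ k)
            + signedFejer m j *
            (chebNode m j ^ 0 * (1 - chebNode m j) ^ b * Real.cos (circleAngle m j) ^ (k + 1))) :=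
          fun j => by
          have : 1 - chebNode m j = (1 + Real.cos (circleAngle m j)) / 2 := by rw [chebNode]; ring
          rw [pow_succ (1 - chebNode m j), pow_succ (Real.cos (circleAngle m j))]
          nth_rewrite 2 [this]
          ring
        simp_rw [this]
        rw [← Finset.mul_sum, Finset.sum_add_distrib, h1, h2]; ring
    | succ a ih =>
      intro b k hk
      have h1 := ih b k (by omega)
      have h2 := ih b (k + 1) (by omega)
      have : ∀ j, signedFejer m j * (chebNode m j ^ (a + 1) * (1 - chebNode m j) ^ b *
          Real.cos (circleAngle m j) ^ k) = 2⁻¹ * (signedFejer m j *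
          (chebNode m j ^ a * (1 - chebNode m j) ^ b * Real.cos (circleAngle m j) ^ k)
          - signedFejer m j *
          (chebNode m j ^ a * (1 - chebNode m j) ^ b * Real.cos (circleAngle m j) ^ (k + 1))) :=
        fun j => by
        have : chebNode m j = (1 - Real.cos (circleAngle m j)) / 2 := by rw [chebNode]
        rw [pow_succ (chebNode m j), pow_succ (Real.cos (circleAngle m j))]
        nth_rewrite 2 [this]
        ring
      simp_rw [this]
      rw [← Finset.mul_sum, Finset.sum_sub_distrib, h1, h2]; ring
  simpa using key a b 0 (by omega)

lemma sum_signedFejer {m : ℕ} (hm : 0 < m) :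
    ∑ j ∈ Finset.range (4 * m), signedFejer m j = 0 := by
  simpa using sum_signedFejer_mul_pow_mul_pow hm 0 0 (by omega)

/-- Signed exponential sums over the nodes. -/
noncomputable def signedExpSum (m : ℕ) (t : ℝ) : ℝ :=
  ∑ j ∈ Finset.range (4 * m), signedFejer m j *
    (Real.exp (-(chebNode m j * t)) + Real.exp (-((1 - chebNode m j) * t)))

lemma signedExpSum_nonneg {m : ℕ} (hm : 0 < m) (t : ℝ) : 0 ≤ signedExpSum m t := by
  have h : signedExpSum m t = 2 * Real.exp (-(t / 2)) * ∑ j ∈ Finset.range (4 * m),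
      signedFejer m j * Real.cosh (t / 2 * Real.cos (circleAngle m j)) := by
    rw [signedExpSum, Finset.mul_sum]
    refine Finset.sum_congr rfl fun j _ => ?_
    have h1 : Real.exp (-(chebNode m j * t))
        = Real.exp (-(t / 2)) * Real.exp (t / 2 * Real.cos (circleAngle m j)) := by
      rw [← Real.exp_add, chebNode]; ring_nf
    have h2 : Real.exp (-((1 - chebNode m j) * t))
        = Real.exp (-(t / 2)) * Real.exp (-(t / 2 * Real.cos (circleAngle m j))) := by
      rw [← Real.exp_add, chebNode]; ring_nf
    rw [h1, h2, Real.cosh_eq]; ring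
  rw [h]
  refine mul_nonneg (by positivity) ?_
  have hs : HasSum (fun k : ℕ => ∑ j ∈ Finset.range (4 * m), signedFejer m j *
      ((t / 2 * Real.cos (circleAngle m j)) ^ (2 * k) / ((2 * k).factorial : ℝ)))
      (∑ j ∈ Finset.range (4 * m),
        signedFejer m j * Real.cosh (t / 2 * Real.cos (circleAngle m j))) :=
    hasSum_sum fun j _ => (Real.hasSum_cosh _).mul_left _
  refine hs.nonneg fun k => ?_
  have : ∑ j ∈ Finset.range (4 * m), signedFejer m j *
      ((t / 2 * Real.cos (circleAngle m j)) ^ (2 * k) / ((2 * k).factorial : ℝ))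
      = (t / 2) ^ (2 * k) / ((2 * k).factorial : ℝ) * ∑ j ∈ Finset.range (4 * m),
        signedFejer m j * Real.cos (circleAngle m j) ^ (2 * k) := by
    rw [Finset.mul_sum]
    refine Finset.sum_congr rfl fun j _ => ?_
    rw [mul_pow]; ring
  rw [this]
  refine mul_nonneg (div_nonneg ?_ (Nat.cast_nonneg _)) (sum_signedFejer_mul_cos_pow hm _).1
  rw [pow_mul]; positivity


lemma fejer_mul_chebNode_of_odd {m : ℕ} (hm : 0 < m) {j : ℕ} (hj : Odd j) :
    fejer m (circleAngle m j) * chebNode m j = 1 / 2 := by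
  obtain ⟨i, rfl⟩ := hj
  have hm' : (m : ℝ) ≠ 0 := by exact_mod_cast hm.ne'
  have h := fejer_mul_one_sub_cos m (circleAngle m (2 * i + 1))
  have hc : Real.cos (m * circleAngle m (2 * i + 1)) = 0 := by
    rw [show (m : ℝ) * circleAngle m (2 * i + 1) = Real.pi / 2 + i * Real.pi by
      rw [circleAngle]; push_cast; field_simp; ring, Real.cos_add_nat_mul_pi]
    simp
  rw [hc] at h
  rw [chebNode]; linarith

lemma exp_neg_le_inv {u : ℝ} (hu : 0 < u) : Real.exp (-u) ≤ u⁻¹ := by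
  rw [Real.exp_neg]
  exact inv_anti₀ hu (by linarith [Real.add_one_le_exp u])

lemma signedExpSum_ge {m : ℕ} (hm : 16 ≤ m) {t : ℝ} (ht : 64 * (m : ℝ) ^ 2 ≤ t) :
    (m : ℝ) ^ 2 / 2 ≤ signedExpSum m t := by
  have hm0 : 0 < m := by omega
  have hmR : (16 : ℝ) ≤ m := by exact_mod_cast hm
  have ht0 : (64 : ℝ) ≤ t := by nlinarith
  have hterm : ∀ j ∈ Finset.range (4 * m),
      (if j = 0 then (m : ℝ) ^ 2 else 0) - (1 + fejer m (circleAngle m j) / 16) ≤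
      signedFejer m j *
        (Real.exp (-(chebNode m j * t)) + Real.exp (-((1 - chebNode m j) * t))) := by
    intro j _
    have hK := fejer_nonneg m (circleAngle m j)
    have hKm := fejer_le m (circleAngle m j)
    have hx := chebNode_mem m j
    have e1 := Real.exp_pos (-(chebNode m j * t))
    have e2 := Real.exp_pos (-((1 - chebNode m j) * t))
    rcases Nat.even_or_odd j with hj | hj
    · rw [signedFejer, hj.neg_one_pow, one_mul]
      split_ifs with h0
      · subst h0
        have h1 : fejer m (circleAngle m 0) = (m : ℝ) ^ 2 := by
          simp [circleAngle, fejer, sq]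
        have h2 : chebNode m 0 = 0 := by simp [chebNode, circleAngle]
        rw [h1, h2, zero_mul, neg_zero, Real.exp_zero]
        rw [h2] at e2
        have h3 := mul_nonneg (sq_nonneg (m : ℝ)) e2.le
        have h4 := sq_nonneg (m : ℝ)
        rw [mul_add, mul_one]
        generalize (m : ℝ) ^ 2 * Real.exp _ = u at h3 ⊢
        generalize (m : ℝ) ^ 2 = w at h4 ⊢
        linarith
      · have : 0 ≤ fejer m (circleAngle m j) * (Real.exp (-(chebNode m j * t)) +
          Real.exp (-((1 - chebNode m j) * t))) := by positivity
        linarith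
    · have hj0 : j ≠ 0 := by rintro rfl; simp at hj
      rw [if_neg hj0, signedFejer, hj.neg_one_pow]
      have hKx := fejer_mul_chebNode_of_odd hm0 hj
      set K := fejer m (circleAngle m j)
      set x := chebNode m j
      have hxpos : 0 < x := by
        rcases hx.1.eq_or_lt with h | h
        · rw [← h] at hKx; norm_num at hKx
        · exact h
      have b1 : K * Real.exp (-(x * t)) ≤ K / 32 := by
        have h1 := exp_neg_le_inv (mul_pos hxpos (by linarith : (0 : ℝ) < t))
        have h2 : (x * t)⁻¹ ≤ 1 / 32 := by
          rw [inv_le_comm₀ (by positivity) (by norm_num)]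
          have h3 : x * (64 * K) ≤ x * t := mul_le_mul_of_nonneg_left (by linarith) hx.1
          nlinarith
        calc K * Real.exp (-(x * t)) ≤ K * (1 / 32) :=
              mul_le_mul_of_nonneg_left (h1.trans h2) hK
          _ = _ := by ring
      have b2 : K * Real.exp (-((1 - x) * t)) ≤ 1 + K / 32 := by
        rcases le_total (1 / 2) x with h | h
        · have hK1 : K ≤ 1 := by nlinarith
          have : Real.exp (-((1 - x) * t)) ≤ 1 :=
            Real.exp_le_one_iff.2 (neg_nonpos.2 (mul_nonneg (sub_nonneg.2 hx.2) (by linarith)))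
          nlinarith
        · have h1 : Real.exp (-((1 - x) * t)) ≤ 1 / 32 := by
            have h2 : 32 ≤ (1 - x) * t := by nlinarith
            refine (exp_neg_le_inv (by linarith)).trans ?_
            rw [inv_le_comm₀ (by linarith) (by norm_num)]
            linarith
          nlinarith [mul_le_mul_of_nonneg_left h1 hK]
      linarith
  have hsum := Finset.sum_le_sum hterm
  rw [Finset.sum_sub_distrib, Finset.sum_add_distrib, ← Finset.sum_div, sum_fejer hm0,
    Finset.sum_ite_eq' (Finset.range (4 * m)) 0 (fun _ => (m : ℝ) ^ 2),
    if_pos (Finset.mem_range.2 (by omega))] at hsum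
  simp only [Finset.sum_const, Finset.card_range, nsmul_eq_mul, mul_one] at hsum
  push_cast at hsum
  rw [signedExpSum]
  nlinarith

/-- Two finitely supported probability measures on `[0, 1]` with matching moments up to order
`m` between which the mean of `x ^ α + (1 - x) ^ α` changes by at least a constant times
`m ^ (-2 α)`. -/
theorem exists_moment_matching {α : ℝ} (hα0 : 0 < α) (hα : α < 1) :
    ∃ c, 0 < c ∧ ∀ m : ℕ, 16 ≤ m → ∃ (N : ℕ) (x : Fin N → ℝ) (ν : Bool → Fin N → ℝ),
      (∀ j, 0 ≤ x j ∧ x j ≤ 1) ∧ (∀ b j, 0 ≤ ν b j) ∧ (∀ b, ∑ j, ν b j = 1) ∧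
      (∀ a b : ℕ, a + b ≤ m → ∑ j, ν true j * (x j ^ a * (1 - x j) ^ b)
        = ∑ j, ν false j * (x j ^ a * (1 - x j) ^ b)) ∧
      c * (m : ℝ) ^ (-2 * α) ≤ ∑ j, ν false j * (x j ^ α + (1 - x j) ^ α)
        - ∑ j, ν true j * (x j ^ α + (1 - x j) ^ α) := by
  obtain ⟨c, hc, hIntegrable⟩ := exists_rpow_eq_integral_exp hα0 hα
  refine ⟨c / (4 * α) * 64 ^ (-α), by positivity, fun m hm => ?_⟩
  have hm0 : 0 < m := by omega
  have hmR : (0 : ℝ) < m := by exact_mod_cast hm0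
  have hrange : ∀ g : ℕ → ℝ, ∑ j : Fin (4 * m), g j = ∑ j ∈ Finset.range (4 * m), g j :=
    fun g => Fin.sum_univ_eq_sum_range g _
  set K : ℕ → ℝ := fun j => fejer m (circleAngle m j) with hKdef
  set sg : Bool → ℝ := fun b => if b then 1 else -1 with hsg
  have hdiff : ∀ g : ℕ → ℝ, ∑ j : Fin (4 * m), (K j + sg false * signedFejer m j) / (4 * m ^ 2) * g j
      - ∑ j : Fin (4 * m), (K j + sg true * signedFejer m j) / (4 * m ^ 2) * g j
      = -(∑ j ∈ Finset.range (4 * m), signedFejer m j * g j) / (2 * m ^ 2) := fun g => by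
    rw [← Finset.sum_sub_distrib, hrange fun j => (K j + sg false * signedFejer m j) / (4 * m ^ 2)
      * g j - (K j + sg true * signedFejer m j) / (4 * m ^ 2) * g j, ← Finset.sum_neg_distrib,
      Finset.sum_div]
    refine Finset.sum_congr rfl fun j _ => ?_
    simp only [hsg, if_true, Bool.false_eq_true, if_false]
    field_simp; ring
  refine ⟨4 * m, fun j => chebNode m j,
    fun b j => (K j + sg b * signedFejer m j) / (4 * m ^ 2), fun j => chebNode_mem m j,
    fun b j => ?_, fun b => ?_, fun a b hab => ?_, ?_⟩
  · have h := abs_le.1 (abs_signedFejer m j).le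
    refine div_nonneg ?_ (by positivity)
    cases b <;> simp only [hsg, hKdef, if_true, Bool.false_eq_true, if_false] <;> linarith [h.1, h.2]
  · rw [hrange fun j => (K j + sg b * signedFejer m j) / (4 * m ^ 2), ← Finset.sum_div,
      Finset.sum_add_distrib, ← Finset.mul_sum, sum_signedFejer hm0, sum_fejer hm0]
    field_simp; ring
  · have h := hdiff fun j => chebNode m j ^ a * (1 - chebNode m j) ^ b
    rw [sum_signedFejer_mul_pow_mul_pow hm0 a b hab, neg_zero, zero_div] at h
    linarith
  · rw [hdiff fun j => chebNode m j ^ α + (1 - chebNode m j) ^ α]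
    have hI : ∀ j, IntegrableOn (fun t => signedFejer m j *
        ((1 - Real.exp (-(chebNode m j * t))) * t ^ (-1 - α)
          + (1 - Real.exp (-((1 - chebNode m j) * t))) * t ^ (-1 - α))) (Ioi 0) := fun j =>
      ((hIntegrable _ (chebNode_mem m j).1).1.add
        (hIntegrable (1 - chebNode m j) (by linarith [(chebNode_mem m j).2])).1).const_mul _
    have hsum : ∀ t : ℝ, ∑ j ∈ Finset.range (4 * m), signedFejer m j *
        ((1 - Real.exp (-(chebNode m j * t))) * t ^ (-1 - α)
          + (1 - Real.exp (-((1 - chebNode m j) * t))) * t ^ (-1 - α))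
        = -(signedExpSum m t * t ^ (-1 - α)) := fun t => by
      have h0 := sum_signedFejer hm0
      rw [signedExpSum, Finset.sum_mul, ← Finset.sum_neg_distrib, ← sub_eq_zero,
        ← Finset.sum_sub_distrib]
      have : ∑ j ∈ Finset.range (4 * m), signedFejer m j * (2 * t ^ (-1 - α)) = 0 := by
        rw [← Finset.sum_mul, h0, zero_mul]
      rw [← this]
      refine Finset.sum_congr rfl fun j _ => ?_
      ring
    have hint1 : IntegrableOn (fun t => signedExpSum m t * t ^ (-1 - α)) (Ioi 0) := by
      have := (integrable_finsetSum (Finset.range (4 * m)) fun j _ => hI j).neg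
      refine this.congr (Filter.Eventually.of_forall fun t => ?_)
      simp only [Pi.neg_apply]
      rw [hsum t, neg_neg]
    have hval : -(∑ j ∈ Finset.range (4 * m), signedFejer m j *
        (chebNode m j ^ α + (1 - chebNode m j) ^ α))
        = c * ∫ t in Ioi 0, signedExpSum m t * t ^ (-1 - α) := by
      have h1 : ∀ j, signedFejer m j * (chebNode m j ^ α + (1 - chebNode m j) ^ α)
          = c * ∫ t in Ioi 0, signedFejer m j *
          ((1 - Real.exp (-(chebNode m j * t))) * t ^ (-1 - α)
          + (1 - Real.exp (-((1 - chebNode m j) * t))) * t ^ (-1 - α)) := fun j => by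
        have a1 := hIntegrable _ (chebNode_mem m j).1
        have a2 := hIntegrable (1 - chebNode m j) (by linarith [(chebNode_mem m j).2])
        rw [integral_const_mul, integral_add a1.1 a2.1, a1.2, a2.2]; ring
      simp_rw [h1]
      rw [← Finset.mul_sum, ← integral_finsetSum _ fun j _ => hI j]
      simp_rw [hsum]
      rw [integral_neg]; ring
    rw [hval]
    have hT : (0 : ℝ) < 64 * (m : ℝ) ^ 2 := by positivity
    have hlow : (m : ℝ) ^ 2 / 2 * ((64 * (m : ℝ) ^ 2) ^ (-α) / α)
        ≤ ∫ t in Ioi 0, signedExpSum m t * t ^ (-1 - α) := by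
      have h1 : ∫ t in Ioi (64 * (m : ℝ) ^ 2), (m : ℝ) ^ 2 / 2 * t ^ (-1 - α)
          = (m : ℝ) ^ 2 / 2 * ((64 * (m : ℝ) ^ 2) ^ (-α) / α) := by
        rw [integral_const_mul, integral_Ioi_rpow_of_lt (by linarith) hT,
          show -1 - α + 1 = -α by ring, neg_div_neg_eq]
      rw [← h1]
      have hsub : Ioi (64 * (m : ℝ) ^ 2) ⊆ Ioi 0 := Ioi_subset_Ioi hT.le
      calc ∫ t in Ioi (64 * (m : ℝ) ^ 2), (m : ℝ) ^ 2 / 2 * t ^ (-1 - α)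
          ≤ ∫ t in Ioi (64 * (m : ℝ) ^ 2), signedExpSum m t * t ^ (-1 - α) :=
            setIntegral_mono_on
              ((integrableOn_Ioi_rpow_of_lt (by linarith) hT).const_mul _)
              (hint1.mono_set hsub) measurableSet_Ioi fun t ht =>
              mul_le_mul_of_nonneg_right (signedExpSum_ge hm (le_of_lt ht))
                (Real.rpow_nonneg (hT.le.trans (le_of_lt ht)) _)
        _ ≤ _ := setIntegral_mono_set hint1
            ((ae_restrict_iff' measurableSet_Ioi).2 <| Filter.Eventually.of_forall fun t ht =>
              mul_nonneg (signedExpSum_nonneg hm0 t) (Real.rpow_nonneg (le_of_lt ht) _))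
            hsub.eventuallyLE
    have hpow : (64 * (m : ℝ) ^ 2) ^ (-α) = 64 ^ (-α) * (m : ℝ) ^ (-2 * α) := by
      rw [Real.mul_rpow (by norm_num) (by positivity), ← Real.rpow_natCast (m : ℝ) 2,
        ← Real.rpow_mul hmR.le]
      push_cast; ring_nf
    rw [le_div_iff₀ (by positivity)]
    refine le_trans (le_of_eq ?_) (mul_le_mul_of_nonneg_left hlow hc.le)
    rw [hpow]
    field_simp; ring

lemma sum_prod_mul_sq_sum {r N : ℕ} {ν g : Fin N → ℝ} (h1 : ∑ a, ν a = 1)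
    (h0 : ∑ a, ν a * g a = 0) :
    ∑ j : Fin r → Fin N, (∏ k, ν (j k)) * (∑ k, g (j k)) ^ 2 = r * ∑ a, ν a * g a ^ 2 := by
  have hexp : ∀ j : Fin r → Fin N, (∏ k, ν (j k)) * (∑ k, g (j k)) ^ 2
      = ∑ k, ∑ l, ∏ i, ν (j i) * ((if i = k then g (j i) else 1) * (if i = l then g (j i) else 1)) :=
    fun j => by
    rw [sq, Finset.sum_mul_sum, Finset.mul_sum]
    refine Finset.sum_congr rfl fun k _ => ?_
    rw [Finset.mul_sum]
    refine Finset.sum_congr rfl fun l _ => ?_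
    rw [Finset.prod_mul_distrib, Finset.prod_mul_distrib, Finset.prod_ite_eq' Finset.univ k,
      Finset.prod_ite_eq' Finset.univ l, if_pos (Finset.mem_univ _), if_pos (Finset.mem_univ _)]
  simp_rw [hexp]
  rw [Finset.sum_comm]
  have hk : ∀ k : Fin r, ∑ j : Fin r → Fin N, ∑ l, ∏ i, ν (j i) *
      ((if i = k then g (j i) else 1) * (if i = l then g (j i) else 1)) = ∑ a, ν a * g a ^ 2 :=
    fun k => by
    rw [Finset.sum_comm]
    have hl : ∀ l : Fin r, ∑ j : Fin r → Fin N, ∏ i, ν (j i) *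
        ((if i = k then g (j i) else 1) * (if i = l then g (j i) else 1))
        = ∏ i, ∑ a, ν a * ((if i = k then g a else 1) * (if i = l then g a else 1)) := fun l =>
      (Fintype.prod_sum fun i a =>
        ν a * ((if i = k then g a else 1) * (if i = l then g a else 1))).symm
    simp_rw [hl]
    rw [Finset.sum_eq_single k]
    · rw [Finset.prod_eq_single k]
      · simp [sq]
      · intro i _ hik
        simp [hik, h1]
      · simp
    · intro l _ hlk
      refine Finset.prod_eq_zero (Finset.mem_univ k) ?_
      simpa [Ne.symm hlk] using h0
    · simp
  rw [Finset.sum_congr rfl fun k _ => hk k]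
  simp

lemma sum_range_poisson_mul_exp_le {x : ℝ} (hx : 0 ≤ x) {c : ℝ} (hc : c = 0 ∨ c = 1) (B : ℕ) :
    ∑ v ∈ Finset.range B, Real.exp (-x) * x ^ v / (v.factorial : ℝ) * Real.exp (c * v)
      ≤ Real.exp (2 * c * x) := by
  have h1 : ∑ v ∈ Finset.range B, Real.exp (-x) * x ^ v / (v.factorial : ℝ) * Real.exp (c * v)
      = Real.exp (-x) * ∑ v ∈ Finset.range B, (x * Real.exp c) ^ v / (v.factorial : ℝ) := by
    rw [Finset.mul_sum]
    refine Finset.sum_congr rfl fun v _ => ?_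
    rw [mul_pow, ← Real.exp_nat_mul, mul_comm c]; ring
  rw [h1]
  calc _ ≤ Real.exp (-x) * Real.exp (x * Real.exp c) :=
        mul_le_mul_of_nonneg_left (Real.sum_le_exp_of_nonneg (by positivity) B)
          (Real.exp_pos _).le
    _ = Real.exp (x * (Real.exp c - 1)) := by rw [← Real.exp_add]; ring_nf
    _ ≤ _ := by
        refine Real.exp_le_exp.2 ?_
        have : Real.exp c - 1 ≤ 2 * c := by
          rcases hc with rfl | rfl
          · simp
          · linarith [Real.exp_one_lt_d9]
        nlinarith

lemma eventually_half_le_sum_poissonPMF {S r m : ℕ} {lam : ℝ} {P : Fin S → ℝ}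
    (hP : ∀ i, 0 ≤ lam * P i) {a b : Fin r → Fin S} (hab : ∀ k, a k ≠ b k)
    (hM : ∀ k, lam * P (a k) + lam * P (b k) ≤ m / 8) (hr : r * Real.exp (-(m / 2)) ≤ 1 / 4) :
    ∀ᶠ B : ℕ in Filter.atTop, 1 / 2 ≤ ∑ z ∈ (Fintype.piFinset fun _ : Fin S => Finset.range B).filter
      (fun z => ∀ k, z (a k) + z (b k) ≤ m), poissonPMF S lam P z := by
  have hlim : Filter.Tendsto (fun B : ℕ => ∏ i, ∑ v ∈ Finset.range B,
      Real.exp (-(lam * P i)) * (lam * P i) ^ v / (v.factorial : ℝ)) Filter.atTop (nhds 1) := by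
    rw [show (1 : ℝ) = ∏ i : Fin S, (1 : ℝ) by simp]
    refine tendsto_finsetProd _ fun i _ => ?_
    exact (hasSum_one_poissonMeasure ⟨lam * P i, hP i⟩).tendsto_sum_nat
  filter_upwards [hlim.eventually_const_lt (show (3 / 4 : ℝ) < 1 by norm_num)] with B hB
  rw [← sum_piFinset_poisson_prod (fun i v =>
    Real.exp (-(lam * P i)) * (lam * P i) ^ v / (v.factorial : ℝ)) B] at hB
  change 3 / 4 < ∑ z ∈ _, poissonPMF S lam P z at hB
  set A := Fintype.piFinset fun _ : Fin S => Finset.range B with hA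
  have hk : ∀ k, ∑ z ∈ A, poissonPMF S lam P z * Real.exp (z (a k) + z (b k) - m)
      ≤ Real.exp (-(m / 2)) := fun k => by
    set c : Fin S → ℝ := fun i => if i = a k ∨ i = b k then 1 else 0 with hc
    have hcsum : ∀ f : Fin S → ℝ, ∑ i, c i * f i = f (a k) + f (b k) := fun f => by
      simp only [hc, ite_mul, one_mul, zero_mul]
      rw [← Finset.sum_filter, show Finset.univ.filter (fun i => i = a k ∨ i = b k)
        = {a k, b k} by ext i; simp, Finset.sum_pair (hab k)]
    have h1 : ∀ z : Fin S → ℕ, poissonPMF S lam P z * Real.exp (z (a k) + z (b k) - m)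
        = Real.exp (-m) * ∏ i, (Real.exp (-(lam * P i)) * (lam * P i) ^ z i /
          ((z i).factorial : ℝ) * Real.exp (c i * z i)) := fun z => by
      rw [Finset.prod_mul_distrib, ← Real.exp_sum, hcsum fun i => (z i : ℝ), poissonPMF,
        sub_eq_add_neg, Real.exp_add]
      ring
    simp_rw [h1]
    rw [← Finset.mul_sum, hA, sum_piFinset_poisson_prod (fun i v =>
      Real.exp (-(lam * P i)) * (lam * P i) ^ v / (v.factorial : ℝ) * Real.exp (c i * v)) B]
    calc _ ≤ Real.exp (-m) * ∏ i, Real.exp (2 * c i * (lam * P i)) := by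
          refine mul_le_mul_of_nonneg_left (Finset.prod_le_prod (fun i _ => ?_) fun i _ => ?_)
            (Real.exp_pos _).le
          · have := hP i
            positivity
          · refine sum_range_poisson_mul_exp_le (hP i) ?_ B
            simp only [hc]; split_ifs <;> simp
      _ = Real.exp (-m + 2 * (lam * P (a k) + lam * P (b k))) := by
          rw [← Real.exp_sum, ← Real.exp_add]
          simp_rw [mul_assoc (2 : ℝ)]
          rw [← Finset.mul_sum, hcsum fun i => lam * P i]
      _ ≤ _ := Real.exp_le_exp.2 (by
          have := hM k
          have : (0 : ℝ) ≤ m := Nat.cast_nonneg m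
          linarith)
  have hsplit : ∑ z ∈ A, poissonPMF S lam P z ≤
      ∑ z ∈ A.filter (fun z => ∀ k, z (a k) + z (b k) ≤ m), poissonPMF S lam P z
      + ∑ k, ∑ z ∈ A, poissonPMF S lam P z * Real.exp (z (a k) + z (b k) - m) := by
    rw [Finset.sum_comm, Finset.sum_filter, ← Finset.sum_add_distrib]
    refine Finset.sum_le_sum fun z _ => ?_
    have hp := poissonPMF_nonneg hP z
    have hnn : ∀ k ∈ Finset.univ,
        0 ≤ poissonPMF S lam P z * Real.exp (z (a k) + z (b k) - m) := fun k _ => by positivity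
    split_ifs with h
    · linarith [Finset.sum_nonneg hnn]
    · push Not at h
      obtain ⟨k, hk⟩ := h
      have h1 := Finset.single_le_sum hnn (Finset.mem_univ k)
      have hkR : (m : ℝ) ≤ z (a k) + z (b k) := by exact_mod_cast hk.le
      have h2 : 1 ≤ Real.exp (z (a k) + z (b k) - m) := Real.one_le_exp (by linarith)
      nlinarith
  have hsum := Finset.sum_le_sum fun k (_ : k ∈ Finset.univ) => hk k
  rw [Finset.sum_const, Finset.card_univ, Fintype.card_fin, nsmul_eq_mul] at hsum
  linarith

lemma prod_pair_sum_equiv {r q S : ℕ} (e : (Fin r × Bool) ⊕ Fin q ≃ Fin S) (g : Fin S → ℝ) :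
    ∏ i, g i = (∏ k, g (e (.inl (k, true))) * g (e (.inl (k, false)))) * ∏ l, g (e (.inr l)) := by
  rw [← e.prod_comp, Fintype.prod_sum_type, Fintype.prod_prod_type]
  simp_rw [Fintype.prod_bool]

lemma sum_pair_sum_equiv {r q S : ℕ} (e : (Fin r × Bool) ⊕ Fin q ≃ Fin S) (g : Fin S → ℝ) :
    ∑ i, g i = (∑ k, (g (e (.inl (k, true))) + g (e (.inl (k, false))))) + ∑ l, g (e (.inr l)) := by
  rw [← e.sum_comp, Fintype.sum_sum_type, Fintype.sum_prod_type]
  simp_rw [Fintype.sum_bool]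

/-- The distribution with `r` pairs of symbols, the `k`-th pair having masses `s * y k` and
`s * (1 - y k)`, and the remaining mass spread uniformly over `q` further symbols. -/
noncomputable def pairDist {r q S : ℕ} (e : (Fin r × Bool) ⊕ Fin q ≃ Fin S) (s : ℝ)
    (y : Fin r → ℝ) (i : Fin S) : ℝ :=
  Sum.elim (fun p => s * (if p.2 then y p.1 else 1 - y p.1)) (fun _ => (1 - r * s) / q) (e.symm i)

section pairDist

variable {r q S : ℕ} (e : (Fin r × Bool) ⊕ Fin q ≃ Fin S) (s : ℝ) (y : Fin r → ℝ)

lemma pairDist_true (k : Fin r) : pairDist e s y (e (.inl (k, true))) = s * y k := by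
  simp [pairDist]

lemma pairDist_false (k : Fin r) : pairDist e s y (e (.inl (k, false))) = s * (1 - y k) := by
  simp [pairDist]

lemma pairDist_inr (l : Fin q) : pairDist e s y (e (.inr l)) = (1 - r * s) / q := by
  simp [pairDist]

variable {s y}

lemma pairDist_mem_simplex (hq : 0 < q) (hs : 0 ≤ s) (hrs : r * s ≤ 1)
    (hy : ∀ k, 0 ≤ y k ∧ y k ≤ 1) : pairDist e s y ∈ simplex S := by
  have hq' : (0 : ℝ) < q := by exact_mod_cast hq
  constructor
  · intro i
    obtain ⟨p, rfl⟩ := e.surjective i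
    rcases p with ⟨k, _ | _⟩ | l
    · rw [pairDist_false]; exact mul_nonneg hs (by linarith [(hy k).2])
    · rw [pairDist_true]; exact mul_nonneg hs (hy k).1
    · rw [pairDist_inr]; exact div_nonneg (by linarith) hq'.le
  · rw [sum_pair_sum_equiv e]
    simp_rw [pairDist_true, pairDist_false, pairDist_inr, ← mul_add]
    simp
    field_simp
    ring

lemma Falpha_pairDist {α : ℝ} (hs : 0 ≤ s) (hy : ∀ k, 0 ≤ y k ∧ y k ≤ 1) :
    Falpha S α (pairDist e s y)
      = s ^ α * ∑ k, (y k ^ α + (1 - y k) ^ α) + q * ((1 - r * s) / q) ^ α := by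
  rw [Falpha, sum_pair_sum_equiv e, Finset.mul_sum]
  congr 1
  · refine Finset.sum_congr rfl fun k _ => ?_
    rw [pairDist_true, pairDist_false, Real.mul_rpow hs (hy k).1,
      Real.mul_rpow hs (by linarith [(hy k).2])]
    ring
  · simp_rw [pairDist_inr]; simp

lemma poissonPMF_pairDist (lam : ℝ) (z : Fin S → ℕ) :
    poissonPMF S lam (pairDist e s y) z =
      (∏ k, Real.exp (-(lam * s)) * (lam * s) ^ (z (e (.inl (k, true))) + z (e (.inl (k, false))))
        / ((z (e (.inl (k, true)))).factorial * (z (e (.inl (k, false)))).factorial : ℝ)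
        * (y k ^ z (e (.inl (k, true))) * (1 - y k) ^ z (e (.inl (k, false)))))
      * ∏ l, Real.exp (-(lam * ((1 - r * s) / q))) * (lam * ((1 - r * s) / q)) ^ z (e (.inr l))
        / ((z (e (.inr l))).factorial : ℝ) := by
  rw [poissonPMF, prod_pair_sum_equiv e]
  simp_rw [pairDist_true, pairDist_false, pairDist_inr]
  congr 1
  refine Finset.prod_congr rfl fun k _ => ?_
  have h : Real.exp (-(lam * s))
      = Real.exp (-(lam * (s * y k))) * Real.exp (-(lam * (s * (1 - y k)))) := by
    rw [← Real.exp_add]; ring_nf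
  rw [h, pow_add, ← mul_assoc lam, ← mul_assoc lam, mul_pow (lam * s), mul_pow (lam * s)]
  field_simp

end pairDist

/-- Lower bound for the minimax risk from two moment-matching priors on pairs of symbols. -/
theorem le_poissonMinimax_of_moment_matching {α n : ℝ} {S r q m N : ℕ}
    (e : (Fin r × Bool) ⊕ Fin q ≃ Fin S) (hq : 0 < q) (hα0 : 0 < α) (hn : 0 < n)
    {x : Fin N → ℝ} {ν : Bool → Fin N → ℝ} (hx : ∀ j, 0 ≤ x j ∧ x j ≤ 1)
    (hν : ∀ b j, 0 ≤ ν b j) (hν1 : ∀ b, ∑ j, ν b j = 1)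
    (hmom : ∀ a b : ℕ, a + b ≤ m → ∑ j, ν true j * (x j ^ a * (1 - x j) ^ b)
        = ∑ j, ν false j * (x j ^ a * (1 - x j) ^ b))
    (hrm : r * (m / 8 / n) ≤ 1) (hr : r * Real.exp (-(m / 2)) ≤ 1 / 4) :
    ENNReal.ofReal (((m / 8 / n) ^ α) ^ 2 * ((r * (∑ j, ν false j * (x j ^ α + (1 - x j) ^ α)
        - ∑ j, ν true j * (x j ^ α + (1 - x j) ^ α))) ^ 2 / 16 - 4 * r))
      ≤ poissonMinimax S n (Falpha S α) := by
  set s : ℝ := m / 8 / n with hs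
  have hs0 : 0 ≤ s := by positivity
  set f : Fin N → ℝ := fun j => x j ^ α + (1 - x j) ^ α with hf
  have hf2 : ∀ j, 0 ≤ f j ∧ f j ≤ 2 := fun j => by
    have h1 := hx j
    have h2 : 0 ≤ 1 - x j := by linarith
    have a1 := Real.rpow_le_one h1.1 h1.2 hα0.le
    have a2 := Real.rpow_le_one h2 (by linarith) hα0.le
    have a3 := Real.rpow_nonneg h1.1 α
    have a4 := Real.rpow_nonneg h2 α
    simp only [hf]
    constructor <;> linarith
  set μ : Bool → ℝ := fun b => ∑ j, ν b j * f j with hμ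
  set D : ℝ := q * ((1 - r * s) / q) ^ α with hD
  set P : (Fin r → Fin N) → Fin S → ℝ := fun j => pairDist e s fun k => x (j k) with hPdef
  set w : Bool → (Fin r → Fin N) → ℝ := fun b j => ∏ k, ν b (j k) with hw
  set t : Bool → ℝ := fun b => s ^ α * (r * μ b) + D with ht
  have hP : ∀ j, P j ∈ simplex S := fun j => pairDist_mem_simplex e hq hs0 hrm fun k => hx _
  have hw0 : ∀ b j, 0 ≤ w b j := fun b j => Finset.prod_nonneg fun k _ => hν b _
  have hw1 : ∀ b, ∑ j, w b j = 1 := fun b => by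
    simp only [hw]
    rw [← Fintype.prod_sum fun (_ : Fin r) a => ν b a]
    simp [hν1]
  have hV : ∀ b, ∑ j, w b j * (Falpha S α (P j) - t b) ^ 2 ≤ (s ^ α) ^ 2 * (4 * r) := fun b => by
    have hdev : ∀ j, Falpha S α (P j) - t b = s ^ α * ∑ k, (f (j k) - μ b) := fun j => by
      simp only [hPdef, ht]
      rw [Falpha_pairDist e hs0 fun k => hx _, Finset.sum_sub_distrib]
      simp only [Finset.sum_const, Finset.card_univ, Fintype.card_fin, nsmul_eq_mul, hD]
      ring
    have hterm : ∀ j, w b j * (Falpha S α (P j) - t b) ^ 2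
        = (s ^ α) ^ 2 * ((∏ k, ν b (j k)) * (∑ k, (f (j k) - μ b)) ^ 2) := fun j => by
      rw [hdev, hw]; ring
    simp_rw [hterm]
    rw [← Finset.mul_sum, sum_prod_mul_sq_sum (g := fun a => f a - μ b) (hν1 b) (by
      simp_rw [mul_sub]
      rw [Finset.sum_sub_distrib, ← Finset.sum_mul, hν1, one_mul, hμ, sub_self])]
    have hμ0 : 0 ≤ μ b := Finset.sum_nonneg fun a _ => mul_nonneg (hν b a) (hf2 a).1
    have hμ2 : μ b ≤ 2 := by
      calc μ b ≤ ∑ a, ν b a * 2 :=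
            Finset.sum_le_sum fun a _ => mul_le_mul_of_nonneg_left (hf2 a).2 (hν b a)
        _ = 2 := by rw [← Finset.sum_mul, hν1, one_mul]
    have h4 : ∑ a, ν b a * (f a - μ b) ^ 2 ≤ 4 := by
      calc ∑ a, ν b a * (f a - μ b) ^ 2 ≤ ∑ a, ν b a * 4 :=
            Finset.sum_le_sum fun a _ => mul_le_mul_of_nonneg_left
              (by nlinarith [(hf2 a).1, (hf2 a).2]) (hν b a)
        _ = 4 := by rw [← Finset.sum_mul, hν1, one_mul]
    refine mul_le_mul_of_nonneg_left ?_ (sq_nonneg _)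
    nlinarith [(Nat.cast_nonneg r : (0 : ℝ) ≤ r)]
  have hmass : ∀ᶠ B : ℕ in Filter.atTop, ∀ j, 1 / 2 ≤
      ∑ z ∈ (Fintype.piFinset fun _ : Fin S => Finset.range B).filter
        (fun z => ∀ k : Fin r, z (e (.inl (k, true))) + z (e (.inl (k, false))) ≤ m),
        poissonPMF S n (P j) z := by
    rw [Filter.eventually_all]
    intro j
    refine eventually_half_le_sum_poissonPMF (a := fun k : Fin r => e (.inl (k, true)))
      (b := fun k : Fin r => e (.inl (k, false)))
      (fun i => mul_nonneg hn.le ((hP j).1 i)) (fun k => by simp) (fun k => ?_) hr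
    simp only [hPdef]
    rw [pairDist_true, pairDist_false, hs]
    apply le_of_eq; field_simp; ring
  obtain ⟨B, hB⟩ := hmass.exists
  set A := (Fintype.piFinset fun _ : Fin S => Finset.range B).filter
    (fun z => ∀ k : Fin r, z (e (.inl (k, true))) + z (e (.inl (k, false))) ≤ m) with hA
  have hagree : ∀ z ∈ A, ∑ j, w false j * poissonPMF S n (P j) z
      = ∑ j, w true j * poissonPMF S n (P j) z := fun z hz => by
    have hz' := (Finset.mem_filter.1 hz).2
    have hmix : ∀ b, ∑ j, w b j * poissonPMF S n (P j) z
        = (∏ k, ∑ a, ν b a * (Real.exp (-(n * s)) *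
          (n * s) ^ (z (e (.inl (k, true))) + z (e (.inl (k, false))))
          / ((z (e (.inl (k, true)))).factorial * (z (e (.inl (k, false)))).factorial : ℝ)
          * (x a ^ z (e (.inl (k, true))) * (1 - x a) ^ z (e (.inl (k, false))))))
        * ∏ l, Real.exp (-(n * ((1 - r * s) / q))) * (n * ((1 - r * s) / q)) ^ z (e (.inr l))
          / ((z (e (.inr l))).factorial : ℝ) := fun b => by
      rw [Fintype.prod_sum, Finset.sum_mul]
      refine Finset.sum_congr rfl fun j _ => ?_
      simp only [hPdef, hw]
      rw [poissonPMF_pairDist, Finset.prod_mul_distrib (f := fun k => ν b (j k)), mul_assoc]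
    rw [hmix, hmix]
    congr 1
    refine Finset.prod_congr rfl fun k _ => ?_
    have hpull : ∀ (c : ℝ) (u v : Fin N → ℝ), ∑ a, u a * (c * v a) = c * ∑ a, u a * v a :=
      fun c u v => by simp_rw [mul_left_comm _ c, Finset.mul_sum]
    rw [hpull, hpull, hmom _ _ (hz' k)]
  have hAff : 1 / 2 ≤ ∑ z ∈ A, min (∑ j, w false j * poissonPMF S n (P j) z)
      (∑ j, w true j * poissonPMF S n (P j) z) := by
    have h1 : ∑ z ∈ A, min (∑ j, w false j * poissonPMF S n (P j) z)
        (∑ j, w true j * poissonPMF S n (P j) z)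
        = ∑ j, w false j * ∑ z ∈ A, poissonPMF S n (P j) z := by
      simp_rw [Finset.mul_sum]
      rw [Finset.sum_comm]
      refine Finset.sum_congr rfl fun z hz => ?_
      rw [← hagree z hz, min_self]
    rw [h1]
    calc (1 / 2 : ℝ) = ∑ j, w false j * (1 / 2) := by rw [← Finset.sum_mul, hw1, one_mul]
      _ ≤ _ := Finset.sum_le_sum fun j _ => mul_le_mul_of_nonneg_left (hB j) (hw0 _ j)
  refine le_trans (ENNReal.ofReal_le_ofReal ?_)
    (le_poissonMinimax_of_mixtures hn.le (Falpha S α) hP hw0 hV A hw1)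
  have hgap : (t true - t false) ^ 2 = (s ^ α) ^ 2 * (r * (μ false - μ true)) ^ 2 := by
    simp only [ht]; ring
  have := mul_le_mul_of_nonneg_left hAff
    (div_nonneg (sq_nonneg (t true - t false)) (by norm_num : (0 : ℝ) ≤ 8))
  rw [hgap] at this ⊢
  linarith

set_option maxHeartbeats 1000000 in
/-- The nonparametric part of the lower bound, valid once `S` exceeds a power of `log n`. -/
theorem nonparametric_le_poissonMinimax {α K β : ℝ} (hα0 : 0 < α) (hα : α < 1) (hK : 0 < K)
    (hβ : β < 1) :
    ∃ c C : ℝ, ∃ n₁ : ℕ, 0 < c ∧ 0 < C ∧ ∀ S n : ℕ, n₁ ≤ n → (S : ℝ) ≤ K * (n : ℝ) ^ β →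
      C * Real.log n ^ (4 * α) ≤ S →
      ENNReal.ofReal (c * ((S : ℝ) ^ 2 / ((n : ℝ) * Real.log n) ^ (2 * α)))
        ≤ poissonMinimax S n (Falpha S α) := by
  obtain ⟨c₁, hc₁, hmm⟩ := exists_moment_matching hα0 hα
  have hev : ∀ᶠ n : ℕ in Filter.atTop,
      4 ≤ Real.log n ∧ K * Real.log n ≤ (n : ℝ) ^ (1 - β) := by
    have h1 := (Real.tendsto_log_atTop.comp tendsto_natCast_atTop_atTop).eventually_ge_atTop
      (4 : ℝ)
    have h2 := tendsto_natCast_atTop_atTop.eventually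
      ((isLittleO_log_rpow_atTop (sub_pos.2 hβ)).bound (inv_pos.2 hK))
    filter_upwards [h1, h2] with n a1 a2
    have a1' : 4 ≤ Real.log n := a1
    refine ⟨a1', ?_⟩
    rw [Real.norm_of_nonneg (by linarith), Real.norm_of_nonneg (by positivity)] at a2
    calc K * Real.log n ≤ K * (K⁻¹ * (n : ℝ) ^ (1 - β)) := mul_le_mul_of_nonneg_left a2 hK.le
      _ = _ := by field_simp
  obtain ⟨n₁, hn₁⟩ := Filter.eventually_atTop.1 hev
  refine ⟨c₁ ^ 2 / 512 * (40 ^ (-α)) ^ 2, 512 * 5 ^ (4 * α) / c₁ ^ 2 + 3, n₁, by positivity,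
    by positivity, fun S n hn hSK hSL => ?_⟩
  obtain ⟨hL, hKL⟩ := hn₁ n hn
  set L := Real.log n with hLdef
  have hn0 : (0 : ℝ) < n := by
    rcases Nat.eq_zero_or_pos n with h | h
    · rw [hLdef, h] at hL; norm_num at hL
    · exact_mod_cast h
  have hn4 : (4 : ℝ) ≤ n := by
    have := Real.add_one_le_exp L
    rw [hLdef, Real.exp_log hn0] at this
    linarith
  set m : ℕ := ⌈4 * L⌉₊ with hm
  have hm1 : 4 * L ≤ m := Nat.le_ceil _
  have hm2 : (m : ℝ) ≤ 5 * L := by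
    have := (Nat.ceil_lt_add_one (show 0 ≤ 4 * L by linarith)).le
    linarith
  have hm16 : 16 ≤ m := by
    have : (16 : ℝ) ≤ m := by linarith
    exact_mod_cast this
  have hm0 : (0 : ℝ) < m := by linarith
  have hL4 : 1 ≤ L ^ (4 * α) := Real.one_le_rpow (by linarith) (by positivity)
  have hC0 : 0 ≤ 512 * 5 ^ (4 * α) / c₁ ^ 2 := by positivity
  have hS3 : 3 ≤ S := by
    have : (3 : ℝ) ≤ S := by nlinarith
    exact_mod_cast this
  set r := (S - 1) / 2 with hr
  have hr4 : (S : ℝ) / 4 ≤ r := by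
    have : S ≤ 4 * r := by omega
    have : (S : ℝ) ≤ 4 * r := by exact_mod_cast this
    linarith
  have hr2 : (r : ℝ) ≤ S / 2 := by
    have : 2 * r ≤ S := by omega
    have : 2 * (r : ℝ) ≤ S := by exact_mod_cast this
    linarith
  have hS0 : (0 : ℝ) < S := by
    have : 0 < S := by omega
    exact_mod_cast this
  have hSLn : (S : ℝ) * L ≤ n := by
    calc (S : ℝ) * L ≤ K * (n : ℝ) ^ β * L := mul_le_mul_of_nonneg_right hSK (by linarith)
      _ = (n : ℝ) ^ β * (K * L) := by ring
      _ ≤ (n : ℝ) ^ β * (n : ℝ) ^ (1 - β) := mul_le_mul_of_nonneg_left hKL (by positivity)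
      _ = n := by rw [← Real.rpow_add hn0]; simp
  obtain ⟨N, x, ν, hx, hν, hν1, hmom, hgap⟩ := hmm m hm16
  have e : (Fin r × Bool) ⊕ Fin (S - 2 * r) ≃ Fin S :=
    Fintype.equivOfCardEq (by simp; omega)
  have hrm : r * ((m : ℝ) / 8 / n) ≤ 1 := by
    rw [← mul_div_assoc, div_le_one hn0]
    have : (r : ℝ) * m ≤ S / 2 * (5 * L) := mul_le_mul hr2 hm2 hm0.le (by positivity)
    linarith
  have hre : r * Real.exp (-((m : ℝ) / 2)) ≤ 1 / 4 := by
    have h1 : Real.exp (-((m : ℝ) / 2)) ≤ 1 / (n * n) := by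
      calc Real.exp (-((m : ℝ) / 2)) ≤ Real.exp (-(L + L)) := Real.exp_le_exp.2 (by linarith)
        _ = 1 / (n * n) := by rw [Real.exp_neg, Real.exp_add, hLdef, Real.exp_log hn0, one_div]
    have h2 : (r : ℝ) ≤ n := by nlinarith
    calc r * Real.exp (-((m : ℝ) / 2)) ≤ n * (1 / (n * n)) :=
          mul_le_mul h2 h1 (Real.exp_pos _).le hn0.le
      _ = 1 / n := by field_simp
      _ ≤ 1 / 4 := one_div_le_one_div_of_le (by norm_num) hn4
  refine le_trans (ENNReal.ofReal_le_ofReal ?_) (le_poissonMinimax_of_moment_matching e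
    (by omega) hα0 hn0 hx hν hν1 hmom hrm hre)
  set Δ := ∑ j, ν false j * (x j ^ α + (1 - x j) ^ α)
    - ∑ j, ν true j * (x j ^ α + (1 - x j) ^ α)
  set δ := (m : ℝ) ^ (-2 * α) with hδ
  have hδ0 : 0 < δ := by positivity
  have hr0 : (0 : ℝ) < r := by linarith [div_pos hS0 (by norm_num : (0 : ℝ) < 4)]
  have hrδ : 128 ≤ r * (c₁ * δ) ^ 2 := by
    have h1 : (5 * L) ^ (-(4 * α)) ≤ δ ^ 2 := by
      rw [hδ, ← Real.rpow_natCast, ← Real.rpow_mul hm0.le,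
        show -2 * α * ((2 : ℕ) : ℝ) = -(4 * α) by push_cast; ring]
      exact Real.rpow_le_rpow_of_nonpos hm0 hm2 (by linarith)
    have h2 : (5 * L) ^ (-(4 * α)) = (5 ^ (4 * α) * L ^ (4 * α))⁻¹ := by
      rw [Real.rpow_neg (by linarith), Real.mul_rpow (by norm_num) (by linarith)]
    have h3 : 512 * 5 ^ (4 * α) / c₁ ^ 2 * L ^ (4 * α) / 4 ≤ r := by nlinarith
    have h5 : (0 : ℝ) < 5 ^ (4 * α) := by positivity
    have hL0 : 0 < L ^ (4 * α) := by linarith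
    calc (128 : ℝ) = 512 * 5 ^ (4 * α) / c₁ ^ 2 * L ^ (4 * α) / 4
          * (c₁ ^ 2 * (5 ^ (4 * α) * L ^ (4 * α))⁻¹) := by field_simp; norm_num
      _ ≤ r * (c₁ ^ 2 * δ ^ 2) := mul_le_mul h3
          (mul_le_mul_of_nonneg_left (h2 ▸ h1) (by positivity)) (by positivity) hr0.le
      _ = _ := by ring
  have hΔ : (r * (c₁ * δ)) ^ 2 ≤ (r * Δ) ^ 2 :=
    pow_le_pow_left₀ (by positivity) (mul_le_mul_of_nonneg_left hgap hr0.le) 2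
  have hY : 40 ^ (-α) * ((n : ℝ) * L) ^ (-α) ≤ ((m : ℝ) / 8 / n) ^ α * δ := by
    have h1 : ((m : ℝ) / 8 / n) ^ α * δ = (8 * (n * m)) ^ (-α) := by
      rw [hδ, show -2 * α = -α + -α by ring, Real.rpow_add hm0, Real.div_rpow (by positivity) hn0.le,
        Real.div_rpow hm0.le (by norm_num), Real.mul_rpow (by norm_num) (by positivity),
        Real.mul_rpow hn0.le hm0.le, Real.rpow_neg hm0.le, Real.rpow_neg hn0.le,
        Real.rpow_neg (by norm_num)]
      field_simp
    rw [h1, ← Real.mul_rpow (by norm_num) (by positivity)]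
    refine Real.rpow_le_rpow_of_nonpos (by positivity) ?_ (by linarith)
    nlinarith
  have hpow : (((n : ℝ) * L) ^ (-α)) ^ 2 = (((n : ℝ) * L) ^ (2 * α))⁻¹ := by
    rw [← Real.rpow_natCast, ← Real.rpow_mul (by positivity), ← Real.rpow_neg (by positivity)]
    congr 1; push_cast; ring
  calc c₁ ^ 2 / 512 * (40 ^ (-α)) ^ 2 * ((S : ℝ) ^ 2 / ((n : ℝ) * L) ^ (2 * α))
      = ((S : ℝ) / 4 * c₁ * (40 ^ (-α) * ((n : ℝ) * L) ^ (-α))) ^ 2 / 32 := by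
        rw [mul_pow _ (40 ^ (-α) * ((n : ℝ) * L) ^ (-α)), mul_pow (40 ^ (-α)), hpow]
        ring
    _ ≤ ((r : ℝ) * c₁ * (((m : ℝ) / 8 / n) ^ α * δ)) ^ 2 / 32 := by
        gcongr
    _ = (((m : ℝ) / 8 / n) ^ α) ^ 2 * ((r * (c₁ * δ)) ^ 2 / 32) := by ring
    _ ≤ _ := by
        refine mul_le_mul_of_nonneg_left ?_ (sq_nonneg _)
        nlinarith

/-- When `S` is at most a power of `log n`, the parametric part of the rate dominates. -/
lemma exists_nonparametric_le_parametric {α : ℝ} (hα0 : 1 / 2 < α) {C : ℝ} (hC : 0 < C) :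
    ∃ D : ℝ, 0 < D ∧ ∀ S n : ℕ, 2 ≤ S → 2 ≤ n → (S : ℝ) ≤ C * max 1 (Real.log n ^ (4 * α)) →
      (S : ℝ) ^ 2 / ((n : ℝ) * Real.log n) ^ (2 * α) ≤ D * ((S : ℝ) ^ (2 - 2 * α) / n) := by
  have hα : 0 < α := by linarith
  set ε := (2 * α - 1) / (8 * α ^ 2) with hε
  have hε0 : 0 < ε := div_pos (by linarith) (by positivity)
  set E := C * (1 + (1 / ε) ^ (4 * α)) with hE
  have hE0 : 0 < E := by positivity
  have hlog2 : 0 < Real.log 2 := Real.log_pos (by norm_num)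
  refine ⟨(E / Real.log 2) ^ (2 * α), by positivity, fun S n hS hn hSC => ?_⟩
  have hS0 : (0 : ℝ) < S := by exact_mod_cast (by omega : 0 < S)
  have hn2 : (2 : ℝ) ≤ n := by exact_mod_cast hn
  have hn0 : (0 : ℝ) < n := by linarith
  have hL2 : Real.log 2 ≤ Real.log n := Real.log_le_log (by norm_num) hn2
  have hL0 : 0 < Real.log n := hlog2.trans_le hL2
  set γ := (2 * α - 1) / (2 * α) with hγ
  have hγ0 : 0 < γ := div_pos (by linarith) (by linarith)
  have hmax : max 1 (Real.log n ^ (4 * α)) ≤ (1 + (1 / ε) ^ (4 * α)) * (n : ℝ) ^ γ := by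
    have h1 : (1 : ℝ) ≤ (n : ℝ) ^ γ := Real.one_le_rpow (by linarith) hγ0.le
    have h2 : Real.log n ^ (4 * α) ≤ (1 / ε) ^ (4 * α) * (n : ℝ) ^ γ := by
      calc Real.log n ^ (4 * α) ≤ ((n : ℝ) ^ ε / ε) ^ (4 * α) :=
            Real.rpow_le_rpow hL0.le (Real.log_le_rpow_div hn0.le hε0) (by linarith)
        _ = (1 / ε) ^ (4 * α) * (n : ℝ) ^ γ := by
            rw [div_eq_mul_one_div, Real.mul_rpow (by positivity) (by positivity),
              ← Real.rpow_mul hn0.le, mul_comm, show ε * (4 * α) = γ by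
                rw [hε, hγ]; field_simp; ring]
    have h3 : 0 ≤ (1 / ε) ^ (4 * α) * (n : ℝ) ^ γ := by positivity
    rw [add_mul, one_mul]
    exact max_le (by linarith) (by linarith)
  have hSn : (S : ℝ) / (n * Real.log n) ≤ E / Real.log 2 * (n : ℝ) ^ (-(1 / (2 * α))) := by
    have h1 : (S : ℝ) ≤ E * (n : ℝ) ^ γ := by
      rw [hE, mul_assoc]; exact hSC.trans (mul_le_mul_of_nonneg_left hmax hC.le)
    have h2 : (n : ℝ) ^ γ = (n : ℝ) ^ (-(1 / (2 * α))) * n := by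
      rw [← Real.rpow_add_one hn0.ne']
      congr 1; rw [hγ]; field_simp; ring
    rw [div_le_iff₀ (by positivity)]
    calc (S : ℝ) ≤ E * (n : ℝ) ^ γ := h1
      _ = E / Real.log 2 * (n : ℝ) ^ (-(1 / (2 * α))) * (n * Real.log 2) := by
          rw [h2]; field_simp
      _ ≤ _ := by gcongr
  have hpow : ((S : ℝ) / (n * Real.log n)) ^ (2 * α) ≤ (E / Real.log 2) ^ (2 * α) * (n : ℝ)⁻¹ := by
    calc _ ≤ (E / Real.log 2 * (n : ℝ) ^ (-(1 / (2 * α)))) ^ (2 * α) :=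
          Real.rpow_le_rpow (by positivity) hSn (by linarith)
      _ = _ := by
          rw [Real.mul_rpow (by positivity) (by positivity), ← Real.rpow_mul hn0.le,
            show -(1 / (2 * α)) * (2 * α) = -1 by field_simp, Real.rpow_neg_one]
  have hsplit : (S : ℝ) ^ 2 = (S : ℝ) ^ (2 - 2 * α) * (S : ℝ) ^ (2 * α) := by
    rw [← Real.rpow_add hS0, sub_add_cancel, Real.rpow_two]
  rw [hsplit, mul_div_assoc, ← Real.div_rpow hS0.le (by positivity)]
  calc _ ≤ (S : ℝ) ^ (2 - 2 * α) * ((E / Real.log 2) ^ (2 * α) * (n : ℝ)⁻¹) :=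
        mul_le_mul_of_nonneg_left hpow (by positivity)
    _ = _ := by ring

/-- The lower bound for the minimax risk. -/
theorem le_poissonMinimax_Falpha {α c₀ : ℝ} (hα0 : 1 / 2 < α) (hα : α < 1) (hc₀ : 0 < c₀) :
    ∃ C, 0 < C ∧ ∀ S n : ℕ, 2 ≤ S → 2 ≤ n → c₀ * (S : ℝ) ^ (1 / α) ≤ (n : ℝ) * Real.log S →
      ENNReal.ofReal (C * ((S : ℝ) ^ 2 / ((n : ℝ) * Real.log n) ^ (2 * α)
        + (S : ℝ) ^ (2 - 2 * α) / (n : ℝ))) ≤ poissonMinimax S n (Falpha S α) := by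
  have hα' : 0 < α := by linarith
  obtain ⟨K, hK, hSK⟩ := exists_le_mul_rpow_of_mul_rpow_le hα' hα hc₀
  have hβ0 : 0 < 2 * α / (1 + α) := by positivity
  have hβ : 2 * α / (1 + α) < 1 := by rw [div_lt_one (by linarith)]; linarith
  obtain ⟨c₂, hc₂, hpar⟩ := parametric_le_poissonMinimax hα' hα
  obtain ⟨c₃, C, n₁, hc₃, hC, hnon⟩ := nonparametric_le_poissonMinimax hα' hα hK hβ
  obtain ⟨D, hD, hdom⟩ := exists_nonparametric_le_parametric hα0
    (show 0 < C + K * (n₁ : ℝ) ^ (2 * α / (1 + α)) by positivity)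
  refine ⟨min (min c₂ c₃ / 2) (c₂ / (D + 1)), by positivity, fun S n hS hn hyp => ?_⟩
  have hn1 : (1 : ℝ) ≤ n := by exact_mod_cast (by omega : 1 ≤ n)
  have hL0 : 0 ≤ Real.log n := Real.log_nonneg hn1
  set R₁ := (S : ℝ) ^ 2 / ((n : ℝ) * Real.log n) ^ (2 * α) with hR₁
  set R₂ := (S : ℝ) ^ (2 - 2 * α) / (n : ℝ) with hR₂
  have hR₁0 : 0 ≤ R₁ := by positivity
  have hR₂0 : 0 ≤ R₂ := by positivity
  have hp := hpar S n hS (by omega)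
  by_cases hcase : n₁ ≤ n ∧ C * Real.log n ^ (4 * α) ≤ S
  · have hq := hnon S n hcase.1 (hSK S n hS hn hyp) hcase.2
    rcases le_total (c₂ * R₂) (c₃ * R₁) with h | h
    · refine le_trans (ENNReal.ofReal_le_ofReal ?_) hq
      calc _ ≤ min c₂ c₃ / 2 * (R₁ + R₂) :=
            mul_le_mul_of_nonneg_right (min_le_left _ _) (by positivity)
        _ ≤ c₃ * R₁ := by
            nlinarith [mul_le_mul_of_nonneg_right (min_le_left c₂ c₃) hR₂0,
              mul_le_mul_of_nonneg_right (min_le_right c₂ c₃) hR₁0]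
    · refine le_trans (ENNReal.ofReal_le_ofReal ?_) hp
      calc _ ≤ min c₂ c₃ / 2 * (R₁ + R₂) :=
            mul_le_mul_of_nonneg_right (min_le_left _ _) (by positivity)
        _ ≤ c₂ * R₂ := by
            nlinarith [mul_le_mul_of_nonneg_right (min_le_left c₂ c₃) hR₂0,
              mul_le_mul_of_nonneg_right (min_le_right c₂ c₃) hR₁0]
  · have hS' : (S : ℝ) ≤ (C + K * (n₁ : ℝ) ^ (2 * α / (1 + α)))
        * max 1 (Real.log n ^ (4 * α)) := by
      have h1 : 0 ≤ K * (n₁ : ℝ) ^ (2 * α / (1 + α)) := by positivity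
      have h2 := le_max_left 1 (Real.log n ^ (4 * α))
      have h3 := le_max_right 1 (Real.log n ^ (4 * α))
      rw [not_and_or, not_le, not_le] at hcase
      rcases hcase with h | h
      · have : (n : ℝ) ^ (2 * α / (1 + α)) ≤ (n₁ : ℝ) ^ (2 * α / (1 + α)) :=
          Real.rpow_le_rpow (by linarith) (by exact_mod_cast h.le) hβ0.le
        have := (hSK S n hS hn hyp).trans (mul_le_mul_of_nonneg_left this hK.le)
        nlinarith
      · nlinarith
    have hR := hdom S n hS hn hS'
    refine le_trans (ENNReal.ofReal_le_ofReal ?_) hp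
    calc _ ≤ c₂ / (D + 1) * (R₁ + R₂) :=
          mul_le_mul_of_nonneg_right (min_le_right _ _) (by positivity)
      _ ≤ c₂ / (D + 1) * ((D + 1) * R₂) :=
          mul_le_mul_of_nonneg_left (by linarith) (by positivity)
      _ = c₂ * R₂ := by field_simp

theorem Falpha_minimax_rate_medium_alpha (α : ℝ) (hα0 : 1 / 2 < α) (hα : α < 1)
    (c₀ : ℝ) (hc₀ : 0 < c₀) :
    ∃ C₁ C₂ : ℝ, 0 < C₁ ∧ 0 < C₂ ∧
      ∀ S n : ℕ, 2 ≤ S → 2 ≤ n →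
        c₀ * (S : ℝ) ^ (1 / α) ≤ (n : ℝ) * Real.log S →
        ENNReal.ofReal (C₁ * ((S : ℝ) ^ 2 / ((n : ℝ) * Real.log n) ^ (2 * α)
              + (S : ℝ) ^ (2 - 2 * α) / (n : ℝ)))
            ≤ poissonMinimax S (n : ℝ) (Falpha S α) ∧
        poissonMinimax S (n : ℝ) (Falpha S α)
            ≤ ENNReal.ofReal (C₂ * ((S : ℝ) ^ 2 / ((n : ℝ) * Real.log n) ^ (2 * α)
              + (S : ℝ) ^ (2 - 2 * α) / (n : ℝ))) := by
  obtain ⟨C₁, hC₁, hlow⟩ := le_poissonMinimax_Falpha hα0 hα hc₀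
  obtain ⟨C₂, hC₂, hup⟩ := poissonMinimax_Falpha_le hα0 hα hc₀
  exact ⟨C₁, C₂, hC₁, hC₂, fun S n hS hn hyp => ⟨hlow S n hS hn hyp, hup S n hS hn hyp⟩⟩
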